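/- arXiv:1001.3296 — 2 statements merged into one kernel-verified Lean document; each statement's English description precedes it below -/
import Mathlib

section
/- Let n ≥ 4 be an integer. There exists a constant C > 0 such that for all nonzero integers a_0,…,a_n with gcd(a_0,…,a_n) = 1, every integer t, and every real B > 0: #M_{a,t}(B) ≤ C·B^{(n−1)/2}. -/
theorem exists_card_divisors_le_rpow {ε : ℝ} (hε : 0 < ε) :
    ∃ C : ℝ, 1 ≤ C ∧ ∀ n : ℕ, n ≠ 0 → (n.divisors.card : ℝ) ≤ C * (n : ℝ) ^ ε := by
  set K : ℝ := max 1 (1 / (ε * Real.log 2)) with hK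
  have hlog : 0 < Real.log 2 := Real.log_pos (by norm_num)
  have hK1 : 1 ≤ K := le_max_left _ _
  have hK2 : 1 ≤ K * (ε * Real.log 2) := by
    rw [← div_le_iff₀ (by positivity)]; exact le_max_right _ _
  set A : ℕ := ⌈(2 : ℝ) ^ (1 / ε)⌉₊ with hA
  refine ⟨K ^ A, one_le_pow₀ hK1, fun n hn => ?_⟩
  have hloc : ∀ p ∈ n.primeFactors, ((n.factorization p + 1 : ℕ) : ℝ) ≤
      (if p < A then K else 1) * ((p : ℝ) ^ n.factorization p) ^ ε := by
    intro p hp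
    have hp2 : (2 : ℝ) ≤ p := by exact_mod_cast (Nat.prime_of_mem_primeFactors hp).two_le
    generalize n.factorization p = v
    have hcomm : ((p : ℝ) ^ v) ^ ε = ((p : ℝ) ^ ε) ^ v := by
      rw [← Real.rpow_natCast, ← Real.rpow_natCast, ← Real.rpow_mul (by positivity),
        ← Real.rpow_mul (by positivity), mul_comm]
    split_ifs with h
    · have h1 : (2 : ℝ) ^ (ε * v) ≤ ((p : ℝ) ^ v) ^ ε := by
        rw [hcomm, Real.rpow_mul (by positivity), Real.rpow_natCast]
        gcongr
      have h2 : 1 + v * (ε * Real.log 2) ≤ (2 : ℝ) ^ (ε * v) := by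
        rw [Real.rpow_def_of_pos (by norm_num)]
        have := Real.add_one_le_exp (Real.log 2 * (ε * v))
        linarith
      have hv : (0 : ℝ) ≤ v := by positivity
      push_cast
      nlinarith
    · have h1 : (2 : ℝ) ≤ (p : ℝ) ^ ε := by
        have : (2 : ℝ) ^ (1 / ε) ≤ p := (Nat.le_ceil _).trans (by exact_mod_cast not_lt.1 h)
        calc (2 : ℝ) = ((2 : ℝ) ^ (1 / ε)) ^ ε := by
              rw [← Real.rpow_mul (by norm_num)]; field_simp; simp
          _ ≤ _ := by gcongr
      rw [hcomm, one_mul]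
      calc ((v + 1 : ℕ) : ℝ) ≤ (2 : ℝ) ^ v := by exact_mod_cast Nat.lt_two_pow_self
        _ ≤ _ := by gcongr
  rw [Nat.card_divisors hn]
  push_cast
  have hprod : ∏ p ∈ n.primeFactors, ((p : ℝ) ^ n.factorization p) ^ ε = (n : ℝ) ^ ε := by
    rw [Real.finsetProd_rpow _ _ (fun i _ => by positivity)]
    congr 1
    exact_mod_cast Nat.prod_factorization_pow_eq_self hn
  calc ∏ p ∈ n.primeFactors, ((n.factorization p : ℝ) + 1)
      ≤ ∏ p ∈ n.primeFactors, (if p < A then K else 1) * ((p : ℝ) ^ n.factorization p) ^ ε :=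
        Finset.prod_le_prod (fun _ _ => by positivity) fun p hp => by simpa using hloc p hp
    _ = K ^ (n.primeFactors.filter (· < A)).card * (n : ℝ) ^ ε := by
        rw [Finset.prod_mul_distrib, hprod, ← Finset.prod_filter, Finset.prod_const]
    _ ≤ _ := by
        gcongr ?_ * _
        refine pow_le_pow_right₀ hK1 ?_
        calc _ ≤ (Finset.range A).card := Finset.card_le_card fun p hp => by
              simpa using (Finset.mem_filter.1 hp).2
          _ = A := Finset.card_range A

open Complex in
/-- The additive character `x ↦ exp (2 π i x)` of `ℝ / ℤ`. -/
noncomputable def unitExp (x : ℝ) : ℂ := exp (I * ((2 * Real.pi * x : ℝ) : ℂ))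

theorem norm_unitExp (x : ℝ) : ‖unitExp x‖ = 1 := Complex.norm_exp_I_mul_ofReal _

theorem unitExp_add (x y : ℝ) : unitExp (x + y) = unitExp x * unitExp y := by
  unfold unitExp
  rw [← Complex.exp_add]
  congr 1
  push_cast
  ring

theorem unitExp_zero : unitExp 0 = 1 := by simp [unitExp]

theorem unitExp_neg (x : ℝ) : unitExp (-x) = (starRingEnd ℂ) (unitExp x) := by
  unfold unitExp
  rw [← Complex.exp_conj]
  congr 1
  rw [map_mul, Complex.conj_I, Complex.conj_ofReal]
  push_cast
  ring

theorem unitExp_intCast (n : ℤ) : unitExp n = 1 := by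
  unfold unitExp
  rw [Complex.exp_eq_one_iff]
  exact ⟨n, by push_cast; ring⟩

theorem unitExp_natCast_mul (n : ℕ) (x : ℝ) : unitExp (n * x) = unitExp x ^ n := by
  unfold unitExp
  rw [← Complex.exp_nat_mul]
  congr 1
  push_cast
  ring

theorem unitExp_sum {ι : Type*} (s : Finset ι) (f : ι → ℝ) :
    unitExp (∑ i ∈ s, f i) = ∏ i ∈ s, unitExp (f i) := by
  classical
  induction s using Finset.induction_on with
  | empty => simp [unitExp_zero]
  | insert a s ha ih => rw [Finset.sum_insert ha, Finset.prod_insert ha, unitExp_add, ih]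

@[fun_prop]
theorem continuous_unitExp : Continuous unitExp := by
  unfold unitExp
  fun_prop

theorem integral_unitExp (m : ℤ) :
    ∫ α in (0 : ℝ)..1, unitExp (m * α) = if m = 0 then 1 else 0 := by
  split_ifs with h
  · simp [h, unitExp_zero]
  · have hc : Complex.I * (2 * Real.pi * m) ≠ 0 := by
      simp [Complex.I_ne_zero, Real.pi_ne_zero, h]
    have : ∀ α : ℝ, unitExp (m * α) = Complex.exp (Complex.I * (2 * Real.pi * m) * α) := by
      intro α
      unfold unitExp
      congr 1
      push_cast
      ring
    simp_rw [this]
    rw [integral_exp_mul_complex hc]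
    have h1 : Complex.exp (Complex.I * (2 * Real.pi * m) * (1 : ℝ)) = 1 := by
      rw [← this 1, mul_one, unitExp_intCast]
    rw [h1]
    simp

theorem four_mul_le_norm_unitExp_sub_one {γ δ : ℝ} (h : ∀ k : ℤ, δ ≤ |γ - k|) :
    4 * δ ≤ ‖unitExp γ - 1‖ := by
  set k := round γ
  have h1 : unitExp γ = unitExp (γ - k) := by
    rw [← mul_one (unitExp (γ - k)), ← unitExp_intCast k, ← unitExp_add, sub_add_cancel]
  have h2 : |γ - k| ≤ 1 / 2 := abs_sub_round γ
  rw [h1, unitExp, Complex.norm_exp_I_mul_ofReal_sub_one, norm_mul, Real.norm_eq_abs,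
    Real.norm_eq_abs, show 2 * Real.pi * (γ - k) / 2 = Real.pi * (γ - k) by ring]
  have h3 := Real.mul_abs_le_abs_sin (x := Real.pi * (γ - k)) (by
    rw [abs_mul, abs_of_pos Real.pi_pos]
    nlinarith [Real.pi_pos])
  rw [abs_mul, abs_of_pos Real.pi_pos, ← mul_assoc, div_mul_cancel₀ _ Real.pi_ne_zero] at h3
  have := h k
  rw [abs_of_pos (by norm_num : (0 : ℝ) < 2)]
  linarith

theorem norm_sum_unitExp_mul_le {γ δ : ℝ} (h : ∀ k : ℤ, δ ≤ |γ - k|) (M : ℕ) :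
    ‖∑ x ∈ Finset.Icc 1 M, unitExp (x * γ)‖ * δ ≤ 1 := by
  have h1 : (∑ x ∈ Finset.Icc 1 M, unitExp (x * γ)) * (unitExp γ - 1) =
      unitExp γ * (unitExp (M * γ) - 1) := by
    simp_rw [unitExp_natCast_mul]
    induction M with
    | zero => simp
    | succ M ih =>
      rw [Finset.sum_Icc_succ_top (by omega), add_mul, ih]
      ring
  have h2 : ‖∑ x ∈ Finset.Icc 1 M, unitExp (x * γ)‖ * ‖unitExp γ - 1‖ ≤ 2 := by
    rw [← norm_mul, h1, norm_mul, norm_unitExp, one_mul]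
    refine (norm_sub_le _ _).trans ?_
    rw [norm_unitExp, norm_one]
    norm_num
  have h3 := mul_le_mul_of_nonneg_left (four_mul_le_norm_unitExp_sub_one h)
    (norm_nonneg (∑ x ∈ Finset.Icc 1 M, unitExp (x * γ)))
  linarith

theorem norm_sum_unitExp_le_card {ι : Type*} (s : Finset ι) (f : ι → ℝ) :
    ‖∑ x ∈ s, unitExp (f x)‖ ≤ s.card := by
  refine (norm_sum_le _ _).trans ?_
  simp [norm_unitExp]

theorem norm_sq_sum_Icc_le (f : ℕ → ℂ) (P : ℕ) :
    ‖∑ x ∈ Finset.Icc 1 P, f x‖ ^ 2 ≤ ∑ x ∈ Finset.Icc 1 P, ‖f x‖ ^ 2 +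
      2 * ‖∑ x ∈ Finset.Icc 1 P, ∑ z ∈ Finset.Ico 1 x, f x * (starRingEnd ℂ) (f z)‖ := by
  have key : ‖∑ x ∈ Finset.Icc 1 P, f x‖ ^ 2 = ∑ x ∈ Finset.Icc 1 P, ‖f x‖ ^ 2 +
      2 * (∑ x ∈ Finset.Icc 1 P, ∑ z ∈ Finset.Ico 1 x, f x * (starRingEnd ℂ) (f z)).re := by
    induction P with
    | zero => simp
    | succ P ih =>
      rw [Finset.sum_Icc_succ_top (by omega), Finset.sum_Icc_succ_top (by omega),
        Finset.sum_Icc_succ_top (by omega), ← Complex.normSq_eq_norm_sq, Complex.normSq_add,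
        Complex.normSq_eq_norm_sq, Complex.normSq_eq_norm_sq, ih, Complex.add_re,
        ← Finset.mul_sum, ← map_sum,
        show Finset.Ico 1 (P + 1) = Finset.Icc 1 P from rfl,
        ← Complex.conj_re (f (P + 1) * _), map_mul, Complex.conj_conj, mul_comm (starRingEnd ℂ _)]
      ring
  rw [key]
  gcongr
  exact Complex.re_le_norm _

theorem norm_sq_sum_unitExp_sq_le (γ : ℝ) (P : ℕ) :
    ‖∑ x ∈ Finset.Icc 1 P, unitExp ((x : ℝ) ^ 2 * γ)‖ ^ 2 ≤
      P + 2 * ∑ h ∈ Finset.Icc 1 P, ‖∑ z ∈ Finset.Icc 1 (P - h), unitExp (z * (2 * γ * h))‖ := by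
  refine (norm_sq_sum_Icc_le _ P).trans ?_
  simp_rw [norm_unitExp]
  have hflip : ∑ x ∈ Finset.Icc 1 P, ∑ z ∈ Finset.Ico 1 x,
      unitExp ((x : ℝ) ^ 2 * γ) * (starRingEnd ℂ) (unitExp ((z : ℝ) ^ 2 * γ)) =
      ∑ h ∈ Finset.Icc 1 P, ∑ z ∈ Finset.Icc 1 (P - h),
        unitExp ((h : ℝ) ^ 2 * γ) * unitExp (z * (2 * γ * h)) := by
    rw [Finset.sum_sigma', Finset.sum_sigma']
    refine Finset.sum_nbij' (fun s => ⟨s.1 - s.2, s.2⟩) (fun s => ⟨s.2 + s.1, s.2⟩) ?_ ?_ ?_ ?_ ?_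
    · rintro ⟨x, z⟩ h
      simp only [Finset.mem_sigma, Finset.mem_Icc, Finset.mem_Ico] at h ⊢
      omega
    · rintro ⟨x, z⟩ h
      simp only [Finset.mem_sigma, Finset.mem_Icc, Finset.mem_Ico] at h ⊢
      omega
    · rintro ⟨x, z⟩ h
      simp only [Finset.mem_sigma, Finset.mem_Icc, Finset.mem_Ico] at h
      simp only [Sigma.mk.injEq, heq_eq_eq, and_true]
      omega
    · rintro ⟨x, z⟩ h
      simp
    · rintro ⟨x, z⟩ h
      simp only [Finset.mem_sigma, Finset.mem_Icc, Finset.mem_Ico] at h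
      rw [← unitExp_neg, ← unitExp_add, ← unitExp_add]
      congr 1
      dsimp only
      rw [Nat.cast_sub (by omega)]
      ring
  rw [hflip]
  simp only [one_pow, Finset.sum_const, Nat.card_Icc, add_tsub_cancel_right, nsmul_eq_mul, mul_one]
  gcongr
  refine (norm_sum_le _ _).trans (Finset.sum_le_sum fun h _ => ?_)
  rw [← Finset.mul_sum, norm_mul, norm_unitExp, one_mul]

theorem sum_range_residue (r : ℕ) [NeZero r] (b : ZMod r) (hb : IsUnit b) (F : ℕ → ℝ) (J : ℕ) :
    ∑ h ∈ Finset.range (r * J), F (b * (h : ZMod r)).val = J * ∑ s ∈ Finset.range r, F s := by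
  have hper : ∀ G : ZMod r → ℝ, ∑ i ∈ Finset.range r, G (i : ZMod r) = ∑ s : ZMod r, G s := by
    intro G
    refine Finset.sum_nbij' (fun i => (i : ZMod r)) ZMod.val ?_ ?_ ?_ ?_ ?_
    · intro i _; simp
    · intro s _; simpa using ZMod.val_lt s
    · intro i hi; exact ZMod.val_cast_of_lt (Finset.mem_range.1 hi)
    · intro s _; simp
    · intro i _; rfl
  induction J with
  | zero => simp
  | succ J ih =>
    rw [Nat.mul_succ, Finset.sum_range_add, ih]
    have h1 : ∑ x ∈ Finset.range r, F (b * ((r * J + x : ℕ) : ZMod r)).val =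
        ∑ s : ZMod r, F (b * s).val := by
      rw [← hper fun s => F (b * s).val]
      simp
    have h2 : ∑ s : ZMod r, F (b * s).val = ∑ s : ZMod r, F s.val :=
      Fintype.sum_bijective (fun s => b * s) (IsUnit.isUnit_iff_mulLeft_bijective.1 hb) _ _
        fun _ => rfl
    have h3 : ∑ s ∈ Finset.range r, F s = ∑ s : ZMod r, F s.val := by
      rw [← hper fun s => F s.val]
      exact Finset.sum_congr rfl fun i hi => by rw [ZMod.val_cast_of_lt (Finset.mem_range.1 hi)]
    rw [h1, h2, ← h3]
    push_cast
    ring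

theorem sum_range_reciprocal_le (r : ℕ) (hr : 0 < r) :
    ∑ s ∈ Finset.range r, (2 * (r : ℝ) / s + 2 * r / (r - s)) ≤ 4 * r * (1 + Real.log r) := by
  have hH : ∑ i ∈ Finset.range r, ((i : ℝ) + 1)⁻¹ ≤ 1 + Real.log r := by
    have := harmonic_le_one_add_log r
    simpa [harmonic] using this
  have h1 : ∑ s ∈ Finset.range r, ((s : ℝ))⁻¹ ≤ ∑ i ∈ Finset.range r, ((i : ℝ) + 1)⁻¹ := by
    obtain ⟨k, rfl⟩ := Nat.exists_eq_succ_of_ne_zero hr.ne'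
    rw [Finset.sum_range_succ', Finset.sum_range_succ]
    simp only [Nat.cast_add, Nat.cast_one, Nat.cast_zero, inv_zero]
    gcongr
    positivity
  have h2 : ∑ s ∈ Finset.range r, ((r : ℝ) - s)⁻¹ = ∑ i ∈ Finset.range r, ((i : ℝ) + 1)⁻¹ := by
    rw [← Finset.sum_range_reflect]
    refine Finset.sum_congr rfl fun i hi => ?_
    have := Finset.mem_range.1 hi
    rw [Nat.cast_sub (by omega), Nat.cast_sub (by omega)]
    congr 1
    push_cast
    ring
  simp_rw [div_eq_mul_inv]
  rw [Finset.sum_add_distrib, ← Finset.mul_sum, ← Finset.mul_sum, h2]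
  have hr' : (0 : ℝ) < r := by exact_mod_cast hr
  nlinarith

theorem sum_inv_sqrt_le (K : ℕ) : ∑ k ∈ Finset.Icc 1 K, (√(k : ℝ))⁻¹ ≤ 2 * √(K : ℝ) := by
  induction K with
  | zero => simp
  | succ K ih =>
    rw [Finset.sum_Icc_succ_top (by omega)]
    refine (add_le_add_left ih _).trans ?_
    have h0 : 0 < √((K + 1 : ℕ) : ℝ) := Real.sqrt_pos.2 (by positivity)
    have h1 : √((K + 1 : ℕ) : ℝ) ^ 2 = K + 1 := by rw [Real.sq_sqrt (by positivity)]; push_cast; ring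
    have h2 : √(K : ℝ) ^ 2 = K := Real.sq_sqrt (by positivity)
    have h3 : √((K + 1 : ℕ) : ℝ)⁻¹ * √((K + 1 : ℕ) : ℝ) = 1 := by
      rw [← Real.sqrt_mul (by positivity), inv_mul_cancel₀ (by positivity), Real.sqrt_one]
    rw [← Real.sqrt_inv]
    set a := √((K + 1 : ℕ) : ℝ)
    set c := √(K : ℝ)
    set d := √((K + 1 : ℕ) : ℝ)⁻¹
    have : (2 * c + d) * a ≤ 2 * a * a := by nlinarith [sq_nonneg (a - c)]
    exact le_of_mul_le_mul_right this h0

section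

variable {r P : ℕ} {b : ℤ} {θ : ℝ} {g : ℕ → ℝ}

theorem sum_not_dvd_le (hr : 0 < r) (hb : IsCoprime b r) (hθ : |θ| * P ≤ 1 / (2 * r))
    (hg : ∀ h ∈ Finset.Icc 1 P, ∀ δ : ℝ,
      (∀ k : ℤ, δ ≤ |((b : ℝ) / r + θ) * h - k|) → g h * δ ≤ 1) :
    ∑ h ∈ (Finset.Icc 1 P).filter (fun h => ¬ r ∣ h), g h ≤ 4 * (P + r) * (1 + Real.log r) := by
  have : NeZero r := ⟨hr.ne'⟩
  have hr' : (0 : ℝ) < r := by exact_mod_cast hr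
  set F : ℕ → ℝ := fun s => 2 * (r : ℝ) / s + 2 * r / (r - s) with hF
  have hbu : IsUnit (b : ZMod r) := by
    obtain ⟨u, v, huv⟩ := hb
    have := congrArg (Int.cast : ℤ → ZMod r) huv
    exact isUnit_iff_exists_inv'.2 ⟨u, by simpa using this⟩
  have hF0 : ∀ s, s < r → 0 ≤ F s := fun s hs => by
    have : (0 : ℝ) < r - s := sub_pos.2 (by exact_mod_cast hs)
    positivity
  have hpt : ∀ h ∈ (Finset.Icc 1 P).filter (fun h => ¬ r ∣ h),
      g h ≤ F ((b : ZMod r) * (h : ZMod r)).val := by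
    intro h hh
    obtain ⟨hhP, hdvd⟩ := Finset.mem_filter.1 hh
    set s := ((b : ZMod r) * (h : ZMod r)).val with hs
    have hsr : s < r := ZMod.val_lt _
    have hs0 : 0 < s := by
      rw [Nat.pos_iff_ne_zero, hs, Ne, ZMod.val_eq_zero, hbu.mul_right_eq_zero,
        ZMod.natCast_eq_zero_iff]
      exact hdvd
    obtain ⟨m, hm⟩ : ∃ m : ℤ, b * h = s + r * m := by
      have : ((b * h : ℤ) : ZMod r) = ((s : ℤ) : ZMod r) := by simp [hs]
      rw [ZMod.intCast_eq_intCast_iff_dvd_sub] at this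
      obtain ⟨m, hm⟩ := this
      exact ⟨-m, by linarith⟩
    have hmR : (b : ℝ) * h = s + r * m := by exact_mod_cast hm
    have hθh : |θ * h| ≤ 1 / (2 * r) := by
      rw [abs_mul, Nat.abs_cast]
      refine le_trans ?_ hθ
      gcongr
      exact (Finset.mem_Icc.1 hhP).2
    have hs1 : (1 : ℝ) ≤ s := by exact_mod_cast hs0
    have hs2 : (1 : ℝ) ≤ r - s := by
      have : (s : ℝ) + 1 ≤ r := by exact_mod_cast hsr
      linarith
    have hpos1 : (0 : ℝ) < s := by linarith
    have hpos2 : (0 : ℝ) < r - s := by linarith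
    have hδ := hg h hhP (min (s / (2 * r)) ((r - s) / (2 * r))) (fun k => by
      have hval : ((b : ℝ) / r + θ) * h - k = s / r + (m - k : ℤ) + θ * h := by
        have : (b : ℝ) / r * h = s / r + m := by field_simp; linarith
        push_cast
        linarith
      rw [hval]
      obtain ⟨hl, hu⟩ := abs_le.1 hθh
      have e1 : (s : ℝ) / (2 * r) + 1 / (2 * r) ≤ s / r := by
        rw [← add_div, div_le_div_iff₀ (by positivity) (by positivity)]; nlinarith
      have e2 : ((r : ℝ) - s) / (2 * r) + 1 / (2 * r) + s / r ≤ 1 := by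
        rw [← add_div, div_add_div _ _ (by positivity) (by positivity), div_le_one (by positivity)]
        nlinarith
      rcases le_or_gt 0 (m - k) with hk | hk
      · have : (0 : ℝ) ≤ (m - k : ℤ) := by exact_mod_cast hk
        refine (min_le_left _ _).trans (le_trans ?_ (le_abs_self _))
        linarith
      · have : ((m - k : ℤ) : ℝ) ≤ -1 := by exact_mod_cast (by omega : m - k ≤ -1)
        refine (min_le_right _ _).trans (le_trans ?_ (neg_le_abs _))
        linarith)
    have a1 : 0 < 2 * (r : ℝ) / s := by positivity
    have a2 : 0 < 2 * (r : ℝ) / (r - s) := by positivity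
    rcases min_cases ((s : ℝ) / (2 * r)) ((r - s) / (2 * r)) with ⟨h1, _⟩ | ⟨h1, _⟩
    · rw [h1, ← le_div_iff₀ (by positivity), one_div_div] at hδ
      exact hδ.trans (le_add_of_nonneg_right a2.le)
    · rw [h1, ← le_div_iff₀ (by positivity), one_div_div] at hδ
      exact hδ.trans (le_add_of_nonneg_left a1.le)
  calc _ ≤ ∑ h ∈ (Finset.Icc 1 P).filter (fun h => ¬ r ∣ h),
        F ((b : ZMod r) * (h : ZMod r)).val := Finset.sum_le_sum hpt
    _ ≤ ∑ h ∈ Finset.range (r * (P / r + 1)), F ((b : ZMod r) * (h : ZMod r)).val := by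
        refine Finset.sum_le_sum_of_subset_of_nonneg (fun h hh => ?_)
          fun h _ _ => hF0 _ (ZMod.val_lt _)
        have := (Finset.mem_Icc.1 (Finset.mem_filter.1 hh).1).2
        have h2 := Nat.lt_mul_div_succ P hr
        exact Finset.mem_range.2 (by omega)
    _ = (P / r + 1 : ℕ) * ∑ s ∈ Finset.range r, F s := sum_range_residue r _ hbu F _
    _ ≤ (P / r + 1) * (4 * r * (1 + Real.log r)) := by
        have := sum_range_reciprocal_le r hr
        gcongr
        · exact Finset.sum_nonneg fun s hs => hF0 s (Finset.mem_range.1 hs)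
        · rw [Nat.cast_add, Nat.cast_one]
          exact add_le_add_left Nat.cast_div_le 1
    _ = _ := by field_simp

theorem sum_dvd_le {p : ℝ} (hr : 0 < r) (hθ : |θ| * P ≤ 1 / (2 * r)) (hp : (P : ℝ) ≤ p)
    (hg0 : ∀ h, 0 ≤ g h) (hgP : ∀ h, g h ≤ P)
    (hg : ∀ h ∈ Finset.Icc 1 P, ∀ δ : ℝ,
      (∀ k : ℤ, δ ≤ |((b : ℝ) / r + θ) * h - k|) → g h * δ ≤ 1) :
    ∑ h ∈ (Finset.Icc 1 P).filter (fun h => r ∣ h), g h ≤ 3 * p ^ 2 / (r * √(1 + p ^ 2 * |θ|)) := by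
  have hr' : (0 : ℝ) < r := by exact_mod_cast hr
  have hr1 : (1 : ℝ) ≤ r := by exact_mod_cast hr
  have hp0 : 0 ≤ p := le_trans (by positivity) hp
  have hPr : ((P / r : ℕ) : ℝ) ≤ p / r := Nat.cast_div_le.trans (by gcongr)
  have hre : ∑ h ∈ (Finset.Icc 1 P).filter (fun h => r ∣ h), g h =
      ∑ k ∈ Finset.Icc 1 (P / r), g (r * k) := by
    symm
    refine Finset.sum_nbij' (fun k => r * k) (fun h => h / r) ?_ ?_ ?_ ?_ ?_
    · intro k hk
      simp only [Finset.mem_Icc, Finset.mem_filter, Nat.le_div_iff_mul_le hr] at hk ⊢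
      refine ⟨⟨Nat.mul_pos hr hk.1, by linarith [hk.2, mul_comm r k]⟩, dvd_mul_right _ _⟩
    · intro h hh
      simp only [Finset.mem_Icc, Finset.mem_filter] at hh ⊢
      exact ⟨Nat.div_pos (Nat.le_of_dvd hh.1.1 hh.2) hr, Nat.div_le_div_right hh.1.2⟩
    · intro k _; exact Nat.mul_div_cancel_left _ hr
    · intro h hh; exact Nat.mul_div_cancel' (Finset.mem_filter.1 hh).2
    · intro k _; rfl
  rw [hre]
  have hu0 : 0 < √(1 + p ^ 2 * |θ|) := Real.sqrt_pos.2 (by positivity)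
  have hu2 : √(1 + p ^ 2 * |θ|) ^ 2 = 1 + p ^ 2 * |θ| := Real.sq_sqrt (by positivity)
  rcases le_or_gt (p ^ 2 * |θ|) 1 with hsmall | hbig
  · calc ∑ k ∈ Finset.Icc 1 (P / r), g (r * k) ≤ ∑ k ∈ Finset.Icc 1 (P / r), p :=
          Finset.sum_le_sum fun k _ => (hgP _).trans hp
      _ = ((P / r : ℕ) : ℝ) * p := by simp
      _ ≤ p / r * p := by gcongr
      _ = p ^ 2 / r * 1 := by ring
      _ ≤ p ^ 2 / r * (3 / √(1 + p ^ 2 * |θ|)) := by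
          gcongr
          rw [le_div_iff₀ hu0, one_mul]
          exact Real.sqrt_le_iff.2 ⟨by norm_num, by linarith⟩
      _ = _ := by field_simp
  · have hθ0 : 0 < |θ| := by
      rcases (abs_nonneg θ).eq_or_lt with h | h
      · rw [← h] at hbig; norm_num at hbig
      · exact h
    have hp1 : 0 < p := by
      rcases hp0.eq_or_lt with h | h
      · rw [← h] at hbig; norm_num at hbig
      · exact h
    have hpt : ∀ k ∈ Finset.Icc 1 (P / r), g (r * k) ≤ √(p / (|θ| * r)) * (√(k : ℝ))⁻¹ := by
      intro k hk
      obtain ⟨hk1, hk2⟩ := Finset.mem_Icc.1 hk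
      have hkP : r * k ≤ P := by
        rw [Nat.le_div_iff_mul_le hr] at hk2
        linarith [mul_comm r k]
      have hkR : (0 : ℝ) < k := by exact_mod_cast hk1
      have hsm : |θ * (r * k : ℕ)| ≤ 1 / 2 := by
        rw [abs_mul, Nat.abs_cast]
        calc |θ| * (r * k : ℕ) ≤ |θ| * P := by gcongr
          _ ≤ 1 / (2 * r) := hθ
          _ ≤ _ := by
              rw [div_le_div_iff₀ (by positivity) (by positivity)]; linarith
      have hδ := hg (r * k) (Finset.mem_Icc.2 ⟨Nat.mul_pos hr hk1, hkP⟩) |θ * (r * k : ℕ)|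
        (fun m => by
          have hval : ((b : ℝ) / r + θ) * (r * k : ℕ) - m = (b * k - m : ℤ) + θ * (r * k : ℕ) := by
            push_cast
            field_simp
            ring
          rw [hval]
          rcases eq_or_ne (b * k - m) 0 with h0 | h0
          · rw [h0]; simp
          · have h1 : (1 : ℝ) ≤ |((b * k - m : ℤ) : ℝ)| := by
              exact_mod_cast Int.one_le_abs h0
            have h2 := abs_sub_abs_le_abs_sub ((b * k - m : ℤ) : ℝ) (-(θ * (r * k : ℕ)))
            rw [abs_neg, sub_neg_eq_add] at h2
            linarith)
      rw [abs_mul, Nat.abs_cast] at hδ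
      push_cast at hδ
      rw [← Real.sqrt_inv, ← Real.sqrt_mul (by positivity)]
      refine Real.le_sqrt_of_sq_le ?_
      have h1 : g (r * k) ≤ 1 / (|θ| * (r * k)) := by
        rw [le_div_iff₀ (by positivity)]; exact hδ
      calc g (r * k) ^ 2 = g (r * k) * g (r * k) := sq _
        _ ≤ p * (1 / (|θ| * (r * k))) :=
            mul_le_mul ((hgP _).trans hp) h1 (hg0 _) hp0
        _ = _ := by field_simp
    calc ∑ k ∈ Finset.Icc 1 (P / r), g (r * k)
        ≤ ∑ k ∈ Finset.Icc 1 (P / r), √(p / (|θ| * r)) * (√(k : ℝ))⁻¹ := Finset.sum_le_sum hpt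
      _ ≤ √(p / (|θ| * r)) * (2 * √((P / r : ℕ) : ℝ)) := by
          rw [← Finset.mul_sum]
          gcongr
          exact sum_inv_sqrt_le _
      _ ≤ √(p / (|θ| * r)) * (2 * √(p / r)) := by gcongr
      _ = 2 * (p ^ 2 / (r * √(p ^ 2 * |θ|))) := by
          rw [mul_left_comm, ← Real.sqrt_mul (by positivity)]
          congr 1
          rw [Real.sqrt_eq_iff_mul_self_eq (by positivity) (by positivity)]
          have : √(p ^ 2 * |θ|) * √(p ^ 2 * |θ|) = p ^ 2 * |θ| := Real.mul_self_sqrt (by positivity)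
          have h0 : √(p ^ 2 * |θ|) ≠ 0 := (Real.sqrt_pos.2 (by positivity)).ne'
          rw [div_mul_div_comm, div_mul_div_comm, mul_mul_mul_comm (r : ℝ), this]
          field_simp
      _ ≤ 3 * p ^ 2 / (r * √(1 + p ^ 2 * |θ|)) := by
          have h0 : 0 < √(p ^ 2 * |θ|) := Real.sqrt_pos.2 (by positivity)
          have h2 : √(p ^ 2 * |θ|) ^ 2 = p ^ 2 * |θ| := Real.sq_sqrt (by positivity)
          rw [← mul_div_assoc, div_le_div_iff₀ (by positivity) (by positivity)]
          have : 2 * √(1 + p ^ 2 * |θ|) ≤ 3 * √(p ^ 2 * |θ|) := by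
            refine abs_le_of_sq_le_sq' (by nlinarith) (by positivity) |>.2
          have h3 : 0 ≤ p ^ 2 * r := by positivity
          nlinarith

/-- Weyl's inequality for quadratic sums, without loss of powers of `P` in the main term. -/
theorem norm_sq_weyl_sum_le {γ p θ : ℝ} {P : ℕ} (ρ : ℚ) (hγ : 2 * γ = ρ + θ)
    (hθ : |θ| * P ≤ 1 / (2 * ρ.den)) (hp : (P : ℝ) ≤ p) :
    ‖∑ x ∈ Finset.Icc 1 P, unitExp ((x : ℝ) ^ 2 * γ)‖ ^ 2 ≤
      6 * p ^ 2 / (ρ.den * √(1 + p ^ 2 * |θ|)) + 9 * (p + ρ.den) * (1 + Real.log ρ.den) := by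
  refine (norm_sq_sum_unitExp_sq_le γ P).trans ?_
  set g : ℕ → ℝ := fun h => ‖∑ z ∈ Finset.Icc 1 (P - h), unitExp (z * (2 * γ * h))‖
  have hρ : (ρ : ℝ) = (ρ.num : ℝ) / ρ.den := Rat.cast_def ρ
  have hg : ∀ h ∈ Finset.Icc 1 P, ∀ δ : ℝ,
      (∀ k : ℤ, δ ≤ |((ρ.num : ℝ) / ρ.den + θ) * h - k|) → g h * δ ≤ 1 := by
    intro h _ δ hδ
    refine norm_sum_unitExp_mul_le (fun k => ?_) _
    rw [hγ, hρ]
    exact hδ k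
  have hgP : ∀ h, g h ≤ P := fun h => by
    refine (norm_sum_unitExp_le_card _ _).trans ?_
    simp
  have hcop : IsCoprime ρ.num (ρ.den : ℤ) := by
    rw [Int.isCoprime_iff_gcd_eq_one]
    exact ρ.reduced
  have h1 := sum_dvd_le (g := g) ρ.pos hθ hp (fun _ => norm_nonneg _) hgP hg
  have h2 := sum_not_dvd_le (g := g) ρ.pos hcop hθ hg
  have hsplit := Finset.sum_filter_add_sum_filter_not (Finset.Icc 1 P) (fun h => ρ.den ∣ h) g
  have hlog : 0 ≤ Real.log ρ.den := Real.log_natCast_nonneg _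
  have hden : (0 : ℝ) < ρ.den := by exact_mod_cast ρ.pos
  have h3 : (4 : ℝ) * (P + ρ.den) * (1 + Real.log ρ.den) ≤ 4 * (p + ρ.den) * (1 + Real.log ρ.den) := by
    gcongr
  have h4 : (P : ℝ) ≤ (p + ρ.den) * (1 + Real.log ρ.den) := by
    have : 0 ≤ p := le_trans (by positivity) hp
    nlinarith
  have h5 : 6 * p ^ 2 / (ρ.den * √(1 + p ^ 2 * |θ|)) =
    2 * (3 * p ^ 2 / (ρ.den * √(1 + p ^ 2 * |θ|))) := by ring
  rw [h5]
  linarith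

end

/-- The largest `x` with `x ^ 2 * y ^ 3 ≤ X`. -/
def sqRange (X y : ℕ) : ℕ := Nat.sqrt (X / y ^ 3)

noncomputable def fiberSum (X y : ℕ) (α : ℝ) : ℂ :=
  ∑ x ∈ Finset.Icc 1 (sqRange X y), unitExp ((x : ℝ) ^ 2 * ((y : ℝ) ^ 3 * α))

noncomputable def sqCubeSum (X : ℕ) (α : ℝ) : ℂ := ∑ y ∈ Finset.Icc 1 X, fiberSum X y α

theorem sqRange_le_sqrt (X y : ℕ) : (sqRange X y : ℝ) ≤ √((X : ℝ) / (y : ℝ) ^ 3) := by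
  refine Real.le_sqrt_of_sq_le ?_
  have h : (sqRange X y) ^ 2 ≤ X / y ^ 3 := Nat.sqrt_le' _
  calc (sqRange X y : ℝ) ^ 2 ≤ ((X / y ^ 3 : ℕ) : ℝ) := by exact_mod_cast h
    _ ≤ (X : ℝ) / ((y ^ 3 : ℕ) : ℝ) := Nat.cast_div_le
    _ = _ := by push_cast; rfl

theorem sqrt_div_cube (X y : ℕ) :
    √((X : ℝ) / (y : ℝ) ^ 3) = (X : ℝ) ^ (1 / 2 : ℝ) * (y : ℝ) ^ (-(3 / 2) : ℝ) := by
  rw [Real.sqrt_eq_rpow, Real.div_rpow (by positivity) (by positivity), Real.rpow_neg (by positivity),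
    ← Real.rpow_natCast, ← Real.rpow_mul (by positivity), div_eq_mul_inv]
  norm_num

theorem norm_fiberSum_le (X y : ℕ) (α : ℝ) :
    ‖fiberSum X y α‖ ≤ (X : ℝ) ^ (1 / 2 : ℝ) * (y : ℝ) ^ (-(3 / 2) : ℝ) := by
  rw [← sqrt_div_cube]
  refine (norm_sum_unitExp_le_card _ _).trans (le_trans ?_ (sqRange_le_sqrt X y))
  simp

theorem exists_sum_rpow_neg_le {s : ℝ} (hs : 1 < s) :
    ∃ C : ℝ, 0 < C ∧ ∀ t : Finset ℕ, ∑ y ∈ t, (y : ℝ) ^ (-s) ≤ C := by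
  have hsum : Summable fun n : ℕ => (n : ℝ) ^ (-s) := Real.summable_nat_rpow.2 (by linarith)
  refine ⟨∑' n : ℕ, (n : ℝ) ^ (-s) + 1, ?_, fun t => ?_⟩
  · have : 0 ≤ ∑' n : ℕ, (n : ℝ) ^ (-s) := tsum_nonneg fun n => by positivity
    linarith
  · have := hsum.sum_le_tsum t fun n _ => by positivity
    linarith

theorem norm_sqCubeSum_le : ∃ C : ℝ, 0 < C ∧ ∀ (X : ℕ) (α : ℝ),
    ‖sqCubeSum X α‖ ≤ C * (X : ℝ) ^ (1 / 2 : ℝ) := by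
  obtain ⟨C, hC, h⟩ := exists_sum_rpow_neg_le (s := 3 / 2) (by norm_num)
  refine ⟨C, hC, fun X α => (norm_sum_le _ _).trans ?_⟩
  calc _ ≤ ∑ y ∈ Finset.Icc 1 X, (X : ℝ) ^ (1 / 2 : ℝ) * (y : ℝ) ^ (-(3 / 2) : ℝ) :=
        Finset.sum_le_sum fun y _ => norm_fiberSum_le X y α
    _ = (∑ y ∈ Finset.Icc 1 X, (y : ℝ) ^ (-(3 / 2) : ℝ)) * (X : ℝ) ^ (1 / 2 : ℝ) := by
        rw [← Finset.mul_sum, mul_comm]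
    _ ≤ _ := by gcongr; exact h _

/-- The denominator of `2 y ^ 3 ρ` is not much smaller than that of `ρ`. -/
theorem den_le_den_two_mul_cube (ρ : ℚ) (y : ℕ) :
    ρ.den ≤ (2 * (y : ℚ) ^ 3 * ρ).den * (2 * ρ.den.gcd y ^ 3) := by
  rcases Nat.eq_zero_or_pos y with rfl | hy
  · simp
    nlinarith [ρ.pos, Nat.one_le_pow 3 ρ.den ρ.pos, Nat.le_self_pow (n := 3) (by norm_num) ρ.den]
  have hcast : (2 * (y : ℚ) ^ 3 * ρ) = ((2 * y ^ 3 : ℕ) : ℚ) * ρ := by push_cast; rfl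
  set c := 2 * y ^ 3
  have hgcd : Nat.gcd ((c : ℤ) * ρ.num).natAbs ρ.den = ρ.den.gcd c := by
    rw [Int.natAbs_mul, Int.natAbs_natCast, Nat.gcd_comm,
      Nat.Coprime.gcd_mul_right_cancel_right _ ρ.reduced]
  have hden : ((c : ℚ) * ρ).den = ρ.den / ρ.den.gcd c := by
    rw [Rat.mul_den]
    simp [hgcd]
  have hle : ρ.den.gcd c ≤ 2 * ρ.den.gcd y ^ 3 := by
    have h1 : ρ.den.gcd c ∣ ρ.den.gcd 2 * ρ.den.gcd (y ^ 3) := Nat.gcd_mul_right_dvd_mul_gcd _ _ _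
    have hg0 : 0 < ρ.den.gcd y := Nat.gcd_pos_of_pos_right _ hy
    have h2 : ρ.den.gcd (y ^ 3) ∣ ρ.den.gcd y ^ 3 := by
      exact gcd_pow_right_dvd_pow_gcd
    exact Nat.le_of_dvd (by positivity) (h1.trans (mul_dvd_mul (Nat.gcd_dvd_right _ _) h2))
  rw [hcast, hden]
  calc ρ.den = ρ.den / ρ.den.gcd c * ρ.den.gcd c :=
        (Nat.div_mul_cancel (Nat.gcd_dvd_left _ _)).symm
    _ ≤ _ := Nat.mul_le_mul_left _ hle

theorem sum_gcd_div_rpow_le {C s : ℝ}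
    (hC : ∀ t : Finset ℕ, ∑ y ∈ t, (y : ℝ) ^ (-s) ≤ C) {q : ℕ} (hq : q ≠ 0)
    (t : Finset ℕ) :
    ∑ y ∈ t, ((q.gcd y : ℝ) / y) ^ s ≤ q.divisors.card * C := by
  have hmap : ∀ y ∈ t, q.gcd y ∈ q.divisors := fun y _ =>
    Nat.mem_divisors.2 ⟨Nat.gcd_dvd_left _ _, hq⟩
  rw [← Finset.sum_fiberwise_of_maps_to hmap, ← nsmul_eq_mul]
  refine Finset.sum_le_card_nsmul _ _ _ fun g hg => ?_
  have hgpos : 0 < g := Nat.pos_of_mem_divisors hg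
  have hinj : Set.InjOn (fun y => y / g) (t.filter fun y => q.gcd y = g) := by
    intro y hy z hz hyz
    have h1 : g ∣ y := (Finset.mem_filter.1 hy).2 ▸ Nat.gcd_dvd_right _ _
    have h2 : g ∣ z := (Finset.mem_filter.1 hz).2 ▸ Nat.gcd_dvd_right _ _
    rw [← Nat.div_mul_cancel h1, ← Nat.div_mul_cancel h2]
    exact congrArg (· * g) hyz
  refine le_trans (le_of_eq ?_) (hC ((t.filter fun y => q.gcd y = g).image fun y => y / g))
  rw [Finset.sum_image hinj]
  refine Finset.sum_congr rfl fun y hy => ?_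
  obtain ⟨hyt, hyg⟩ := Finset.mem_filter.1 hy
  obtain ⟨m, rfl⟩ : g ∣ y := hyg ▸ Nat.gcd_dvd_right _ _
  have hm : (0 : ℝ) ≤ m := by positivity
  rw [hyg, Nat.mul_div_cancel_left _ hgpos, Real.rpow_neg hm, ← Real.inv_rpow hm]
  congr 1
  push_cast
  field_simp

theorem norm_fiberSum_le_of_close {X y : ℕ} {α : ℝ} {ρ : ℚ} (hX : 1 ≤ X) (hy : 1 ≤ y)
    (hyX : (y : ℝ) ≤ (X : ℝ) ^ (0.12 : ℝ)) (hden : (ρ.den : ℝ) ≤ 5 * (X : ℝ) ^ (0.68 : ℝ))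
    (hα : |α - ρ| ≤ 1 / (4 * (X : ℝ) ^ (0.68 : ℝ) * ρ.den)) :
    ‖fiberSum X y α‖ ≤ 4 * (X : ℝ) ^ (1 / 2 : ℝ) * (ρ.den : ℝ) ^ (-(1 / 2) : ℝ) *
      (1 + X * |α - ρ|) ^ (-(1 / 4) : ℝ) * ((ρ.den.gcd y : ℝ) / y) ^ (3 / 2 : ℝ) +
      120 * (X : ℝ) ^ (0.35 : ℝ) := by
  set β := α - ρ with hβ
  set q := ρ.den with hq
  set r := (2 * (y : ℚ) ^ 3 * ρ).den with hr
  set g := q.gcd y with hg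
  have hX1 : (1 : ℝ) ≤ X := by exact_mod_cast hX
  have hX0 : (0 : ℝ) < X := by linarith
  have hy0 : (0 : ℝ) < y := by exact_mod_cast hy
  have hq0 : (0 : ℝ) < q := by exact_mod_cast ρ.pos
  have hr0 : (0 : ℝ) < r := Nat.cast_pos.2 (Rat.pos _)
  have hg0 : (0 : ℝ) < g := by exact_mod_cast Nat.gcd_pos_of_pos_right _ hy
  have hrq : (r : ℝ) ≤ q := by
    have h : r ∣ q := by
      have := Rat.mul_den_dvd (2 * (y : ℚ) ^ 3) ρ
      have h1 : (2 * (y : ℚ) ^ 3).den = 1 := by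
        have : (2 * (y : ℚ) ^ 3) = ((2 * y ^ 3 : ℕ) : ℚ) := by push_cast; rfl
        rw [this]; exact Rat.den_natCast _
      rwa [h1, one_mul] at this
    exact_mod_cast Nat.le_of_dvd ρ.pos h
  have hqr : (q : ℝ) ≤ r * (2 * (g : ℝ) ^ 3) := by
    have h : q ≤ r * (2 * g ^ 3) := den_le_den_two_mul_cube ρ y
    exact_mod_cast h
  set p := √((X : ℝ) / (y : ℝ) ^ 3) with hp
  have hp2 : p ^ 2 = X / (y : ℝ) ^ 3 := Real.sq_sqrt (by positivity)
  have hp0 : 0 ≤ p := Real.sqrt_nonneg _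
  have hpX : p ≤ (X : ℝ) ^ (0.68 : ℝ) := by
    calc p ≤ √(X : ℝ) := Real.sqrt_le_sqrt (div_le_self hX0.le (one_le_pow₀ (by exact_mod_cast hy)))
      _ = (X : ℝ) ^ (1 / 2 : ℝ) := Real.sqrt_eq_rpow _
      _ ≤ _ := Real.rpow_le_rpow_of_exponent_le hX1 (by norm_num)
  have hyp : (y : ℝ) ^ 3 * p ≤ (X : ℝ) ^ (0.68 : ℝ) := by
    have h1 : (y : ℝ) ^ 3 * p = (X : ℝ) ^ (1 / 2 : ℝ) * (y : ℝ) ^ (3 / 2 : ℝ) := by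
      rw [hp, sqrt_div_cube, mul_left_comm, ← Real.rpow_natCast, ← Real.rpow_add hy0]
      norm_num
    have h2 : (y : ℝ) ^ (3 / 2 : ℝ) ≤ ((X : ℝ) ^ (0.12 : ℝ)) ^ (3 / 2 : ℝ) := by gcongr
    rw [← Real.rpow_mul hX0.le] at h2
    rw [h1]
    calc _ ≤ (X : ℝ) ^ (1 / 2 : ℝ) * (X : ℝ) ^ (0.12 * (3 / 2) : ℝ) := by gcongr
      _ = _ := by rw [← Real.rpow_add hX0]; norm_num
  have hXr : 0 < (X : ℝ) ^ (0.68 : ℝ) := by positivity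
  have hweyl := norm_sq_weyl_sum_le (γ := (y : ℝ) ^ 3 * α) (θ := 2 * (y : ℝ) ^ 3 * β) (p := p)
    (P := sqRange X y) (2 * (y : ℚ) ^ 3 * ρ) (by push_cast; rw [hβ]; ring) (by
      rw [abs_mul, abs_of_pos (by positivity : (0 : ℝ) < 2 * (y : ℝ) ^ 3)]
      calc 2 * (y : ℝ) ^ 3 * |β| * (sqRange X y)
          ≤ 2 * (y : ℝ) ^ 3 * (1 / (4 * (X : ℝ) ^ (0.68 : ℝ) * q)) * p := by
            gcongr; exact sqRange_le_sqrt X y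
        _ = (y : ℝ) ^ 3 * p * (1 / (2 * (X : ℝ) ^ (0.68 : ℝ) * q)) := by field_simp; norm_num
        _ ≤ (X : ℝ) ^ (0.68 : ℝ) * (1 / (2 * (X : ℝ) ^ (0.68 : ℝ) * q)) := by gcongr
        _ = 1 / (2 * q) := by field_simp
        _ ≤ 1 / (2 * r) := by gcongr) (sqRange_le_sqrt X y)
  have hmain : 6 * p ^ 2 / (r * √(1 + p ^ 2 * |2 * (y : ℝ) ^ 3 * β|)) ≤
      (4 * (X : ℝ) ^ (1 / 2 : ℝ) * (q : ℝ) ^ (-(1 / 2) : ℝ) *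
      (1 + X * |β|) ^ (-(1 / 4) : ℝ) * ((g : ℝ) / y) ^ (3 / 2 : ℝ)) ^ 2 := by
    have hu : 0 < 1 + (X : ℝ) * |β| := by positivity
    have e1 : ((X : ℝ) ^ (1 / 2 : ℝ)) ^ 2 = X := by
      rw [← Real.rpow_natCast, ← Real.rpow_mul hX0.le]; norm_num
    have e2 : ((q : ℝ) ^ (-(1 / 2) : ℝ)) ^ 2 = (q : ℝ)⁻¹ := by
      rw [← Real.rpow_natCast, ← Real.rpow_mul hq0.le, ← Real.rpow_neg_one]; norm_num
    have e3 : ((1 + X * |β|) ^ (-(1 / 4) : ℝ)) ^ 2 = (√(1 + X * |β|))⁻¹ := by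
      rw [← Real.rpow_natCast, ← Real.rpow_mul hu.le, Real.sqrt_eq_rpow, ← Real.rpow_neg hu.le]
      norm_num
    have e4 : (((g : ℝ) / y) ^ (3 / 2 : ℝ)) ^ 2 = ((g : ℝ) / y) ^ 3 := by
      rw [← Real.rpow_natCast, ← Real.rpow_mul (by positivity), ← Real.rpow_natCast]; norm_num
    rw [mul_pow, mul_pow, mul_pow, mul_pow, e1, e2, e3, e4]
    have hs : √(1 + X * |β|) ≤ √(1 + p ^ 2 * |2 * (y : ℝ) ^ 3 * β|) := by
      refine Real.sqrt_le_sqrt ?_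
      rw [abs_mul, abs_of_pos (by positivity : (0 : ℝ) < 2 * (y : ℝ) ^ 3), hp2]
      have : (X : ℝ) / (y : ℝ) ^ 3 * (2 * (y : ℝ) ^ 3 * |β|) = 2 * (X * |β|) := by field_simp
      rw [this]
      have : 0 ≤ (X : ℝ) * |β| := by positivity
      linarith
    have hs0 : 0 < √(1 + X * |β|) := Real.sqrt_pos.2 hu
    calc _ ≤ 6 * p ^ 2 / (r * √(1 + X * |β|)) := by gcongr
      _ = 6 * X / (y : ℝ) ^ 3 * (r : ℝ)⁻¹ * (√(1 + X * |β|))⁻¹ := by rw [hp2]; field_simp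
      _ ≤ 6 * X / (y : ℝ) ^ 3 * (2 * (g : ℝ) ^ 3 / q) * (√(1 + X * |β|))⁻¹ := by
          gcongr
          rw [le_div_iff₀ hq0, inv_mul_le_iff₀ hr0]
          exact hqr
      _ = 12 * (X * (q : ℝ)⁻¹ * (√(1 + X * |β|))⁻¹ * ((g : ℝ) / y) ^ 3) := by field_simp; norm_num
      _ ≤ 4 ^ 2 * (X * (q : ℝ)⁻¹ * (√(1 + X * |β|))⁻¹ * ((g : ℝ) / y) ^ 3) := by
          gcongr; norm_num
      _ = _ := by ring
  have herr : 9 * (p + r) * (1 + Real.log r) ≤ (120 * (X : ℝ) ^ (0.35 : ℝ)) ^ 2 := by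
    have hr1 : (1 : ℝ) ≤ r := Nat.one_le_cast.2 (Rat.pos _)
    have hr5 : (r : ℝ) ≤ 5 * (X : ℝ) ^ (0.68 : ℝ) := hrq.trans hden
    have hlog : Real.log r ≤ 250 * (X : ℝ) ^ (0.02 : ℝ) := by
      calc Real.log r ≤ (r : ℝ) ^ (0.02 : ℝ) / 0.02 := Real.log_le_rpow_div hr0.le (by norm_num)
        _ ≤ (5 * (X : ℝ)) ^ (0.02 : ℝ) / 0.02 := by
            gcongr
            refine hr5.trans ?_
            gcongr
            calc (X : ℝ) ^ (0.68 : ℝ) ≤ (X : ℝ) ^ (1 : ℝ) :=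
                  Real.rpow_le_rpow_of_exponent_le hX1 (by norm_num)
              _ = X := Real.rpow_one _
        _ = (5 : ℝ) ^ (0.02 : ℝ) * (X : ℝ) ^ (0.02 : ℝ) / 0.02 := by
            rw [Real.mul_rpow (by norm_num) hX0.le]
        _ ≤ 5 * (X : ℝ) ^ (0.02 : ℝ) / 0.02 := by
            gcongr
            calc (5 : ℝ) ^ (0.02 : ℝ) ≤ (5 : ℝ) ^ (1 : ℝ) :=
                  Real.rpow_le_rpow_of_exponent_le (by norm_num) (by norm_num)
              _ = 5 := Real.rpow_one _
        _ = _ := by ring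
    have h1 : (1 : ℝ) ≤ (X : ℝ) ^ (0.02 : ℝ) := Real.one_le_rpow hX1 (by norm_num)
    have hlog0 : 0 ≤ Real.log r := Real.log_nonneg hr1
    calc 9 * (p + r) * (1 + Real.log r)
        ≤ 9 * ((X : ℝ) ^ (0.68 : ℝ) + 5 * (X : ℝ) ^ (0.68 : ℝ)) *
          ((X : ℝ) ^ (0.02 : ℝ) + 250 * (X : ℝ) ^ (0.02 : ℝ)) := by gcongr
      _ = 9 * 6 * 251 * ((X : ℝ) ^ (0.68 : ℝ) * (X : ℝ) ^ (0.02 : ℝ)) := by ring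
      _ = 9 * 6 * 251 * (X : ℝ) ^ (0.7 : ℝ) := by rw [← Real.rpow_add hX0]; norm_num
      _ ≤ 120 ^ 2 * (X : ℝ) ^ (0.7 : ℝ) := by gcongr; norm_num
      _ = _ := by rw [mul_pow, sq ((X : ℝ) ^ (0.35 : ℝ)), ← Real.rpow_add hX0]; norm_num
  set A := 4 * (X : ℝ) ^ (1 / 2 : ℝ) * (q : ℝ) ^ (-(1 / 2) : ℝ) *
      (1 + X * |β|) ^ (-(1 / 4) : ℝ) * ((g : ℝ) / y) ^ (3 / 2 : ℝ)
  set D := 120 * (X : ℝ) ^ (0.35 : ℝ)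
  have hA : 0 ≤ A := by positivity
  have hD : 0 ≤ D := by positivity
  refine abs_le_of_sq_le_sq' ?_ (by positivity) |>.2
  have : ‖fiberSum X y α‖ ^ 2 ≤ A ^ 2 + D ^ 2 := hweyl.trans (add_le_add hmain herr)
  nlinarith

theorem exists_rat_norm_sqCubeSum_le : ∃ C : ℝ, 0 < C ∧ ∀ (X : ℕ), 1 ≤ X → ∀ α ∈ Set.Icc (0 : ℝ) 1,
    ∃ ρ : ℚ, ρ.den ≤ 5 * X ∧ |ρ.num| ≤ 2 * ρ.den ∧
      ‖sqCubeSum X α‖ ≤ C * (X : ℝ) ^ (1 / 2 : ℝ) * (ρ.den : ℝ) ^ (-0.495 : ℝ) *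
        (1 + X * |α - ρ|) ^ (-(1 / 4) : ℝ) + C * (X : ℝ) ^ (0.47 : ℝ) := by
  obtain ⟨C₁, hC₁, h₁⟩ := exists_sum_rpow_neg_le (s := 3 / 2) (by norm_num)
  obtain ⟨C₂, hC₂, h₂⟩ := exists_sum_rpow_neg_le (s := 5 / 4) (by norm_num)
  obtain ⟨C₃, hC₃, h₃⟩ := exists_card_divisors_le_rpow (ε := 0.005) (by norm_num)
  refine ⟨4 * C₁ * C₃ + 120 + C₂, by positivity, fun X hX α hα => ?_⟩
  have hX1 : (1 : ℝ) ≤ X := by exact_mod_cast hX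
  have hX0 : (0 : ℝ) < X := by linarith
  have hXr : 1 ≤ (X : ℝ) ^ (0.68 : ℝ) := Real.one_le_rpow hX1 (by norm_num)
  set N := ⌈4 * (X : ℝ) ^ (0.68 : ℝ)⌉₊ with hN
  have hN0 : 0 < N := Nat.ceil_pos.2 (by positivity)
  have hN1 : 4 * (X : ℝ) ^ (0.68 : ℝ) ≤ N := Nat.le_ceil _
  have hN2 : (N : ℝ) ≤ 5 * (X : ℝ) ^ (0.68 : ℝ) := by
    have := Nat.ceil_lt_add_one (by positivity : 0 ≤ 4 * (X : ℝ) ^ (0.68 : ℝ))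
    rw [← hN] at this
    linarith
  obtain ⟨ρ, hρ, hρN⟩ := Real.exists_rat_abs_sub_le_and_den_le α hN0
  have hq1 : (1 : ℝ) ≤ ρ.den := by exact_mod_cast ρ.pos
  have hden : (ρ.den : ℝ) ≤ 5 * (X : ℝ) ^ (0.68 : ℝ) := le_trans (by exact_mod_cast hρN) hN2
  have hβ : |α - ρ| ≤ 1 / (4 * (X : ℝ) ^ (0.68 : ℝ) * ρ.den) := by
    refine hρ.trans ?_
    gcongr
    linarith
  refine ⟨ρ, ?_, ?_, ?_⟩
  · have : (X : ℝ) ^ (0.68 : ℝ) ≤ X := by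
      conv_rhs => rw [← Real.rpow_one (X : ℝ)]
      exact Real.rpow_le_rpow_of_exponent_le hX1 (by norm_num)
    exact_mod_cast (by linarith : (ρ.den : ℝ) ≤ 5 * X)
  · have h1 : |α - ρ| ≤ 1 := by
      refine hβ.trans ?_
      rw [div_le_one (by positivity)]
      nlinarith
    have h2 : |(ρ : ℝ)| ≤ 2 := by
      obtain ⟨h3, h4⟩ := abs_le.1 h1
      exact abs_le.2 ⟨by linarith [hα.1], by linarith [hα.2]⟩
    rw [Rat.cast_def, abs_div, Nat.abs_cast, div_le_iff₀ (by linarith)] at h2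
    exact_mod_cast h2
  set M := (X : ℝ) ^ (1 / 2 : ℝ) * (ρ.den : ℝ) ^ (-(1 / 2) : ℝ) *
    (1 + X * |α - ρ|) ^ (-(1 / 4) : ℝ) with hM
  have hu : 0 < 1 + (X : ℝ) * |α - ρ| := by positivity
  have hM0 : 0 ≤ M := by positivity
  rw [sqCubeSum, ← Finset.sum_filter_add_sum_filter_not _ fun y : ℕ => (y : ℝ) ≤ (X : ℝ) ^ (0.12 : ℝ)]
  set s₁ := (Finset.Icc 1 X).filter fun y : ℕ => (y : ℝ) ≤ (X : ℝ) ^ (0.12 : ℝ)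
  set s₂ := (Finset.Icc 1 X).filter fun y : ℕ => ¬ (y : ℝ) ≤ (X : ℝ) ^ (0.12 : ℝ)
  have hs₁ : ‖∑ y ∈ s₁, fiberSum X y α‖ ≤
      4 * C₁ * C₃ * (M * (ρ.den : ℝ) ^ (0.005 : ℝ)) + 120 * (X : ℝ) ^ (0.47 : ℝ) := by
    calc _ ≤ ∑ y ∈ s₁, (4 * M * ((ρ.den.gcd y : ℝ) / y) ^ (3 / 2 : ℝ) +
          120 * (X : ℝ) ^ (0.35 : ℝ)) := by
          refine (norm_sum_le _ _).trans (Finset.sum_le_sum fun y hy => ?_)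
          obtain ⟨hy1, hy2⟩ := Finset.mem_filter.1 hy
          refine (norm_fiberSum_le_of_close hX (Finset.mem_Icc.1 hy1).1 hy2 hden hβ).trans_eq ?_
          rw [hM]
          ring
      _ = 4 * M * ∑ y ∈ s₁, ((ρ.den.gcd y : ℝ) / y) ^ (3 / 2 : ℝ) +
          s₁.card * (120 * (X : ℝ) ^ (0.35 : ℝ)) := by
          rw [Finset.sum_add_distrib, ← Finset.mul_sum, Finset.sum_const, nsmul_eq_mul]
      _ ≤ 4 * M * ((C₃ * (ρ.den : ℝ) ^ (0.005 : ℝ)) * C₁) +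
          (X : ℝ) ^ (0.12 : ℝ) * (120 * (X : ℝ) ^ (0.35 : ℝ)) := by
          gcongr
          · refine (sum_gcd_div_rpow_le h₁ ρ.den_nz s₁).trans ?_
            gcongr
            exact h₃ _ ρ.den_nz
          · have : s₁ ⊆ Finset.Icc 1 ⌊(X : ℝ) ^ (0.12 : ℝ)⌋₊ := fun y hy => by
              obtain ⟨hy1, hy2⟩ := Finset.mem_filter.1 hy
              exact Finset.mem_Icc.2 ⟨(Finset.mem_Icc.1 hy1).1, Nat.le_floor hy2⟩
            have h := Finset.card_le_card this
            rw [Nat.card_Icc, Nat.add_sub_cancel] at h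
            exact le_trans (by exact_mod_cast h) (Nat.floor_le (by positivity))
      _ = 4 * C₁ * C₃ * (M * (ρ.den : ℝ) ^ (0.005 : ℝ)) +
          120 * ((X : ℝ) ^ (0.12 : ℝ) * (X : ℝ) ^ (0.35 : ℝ)) := by ring
      _ = _ := by rw [← Real.rpow_add hX0]; norm_num
  have hs₂ : ‖∑ y ∈ s₂, fiberSum X y α‖ ≤ C₂ * (X : ℝ) ^ (0.47 : ℝ) := by
    calc _ ≤ ∑ y ∈ s₂, (X : ℝ) ^ (0.47 : ℝ) * (y : ℝ) ^ (-(5 / 4) : ℝ) := by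
          refine (norm_sum_le _ _).trans (Finset.sum_le_sum fun y hy => ?_)
          obtain ⟨hy1, hy2⟩ := Finset.mem_filter.1 hy
          have hy0 : (0 : ℝ) < y := by exact_mod_cast (Finset.mem_Icc.1 hy1).1
          refine (norm_fiberSum_le X y α).trans ?_
          have h5 : (y : ℝ) ^ (-(1 / 4) : ℝ) ≤ ((X : ℝ) ^ (0.12 : ℝ)) ^ (-(1 / 4) : ℝ) :=
            Real.rpow_le_rpow_of_nonpos (by positivity) (not_le.1 hy2).le (by norm_num)
          rw [← Real.rpow_mul hX0.le] at h5
          calc _ = (X : ℝ) ^ (1 / 2 : ℝ) * ((y : ℝ) ^ (-(1 / 4) : ℝ) * (y : ℝ) ^ (-(5 / 4) : ℝ)) := by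
                rw [← Real.rpow_add hy0]; norm_num
            _ ≤ (X : ℝ) ^ (1 / 2 : ℝ) *
                ((X : ℝ) ^ (0.12 * (-(1 / 4)) : ℝ) * (y : ℝ) ^ (-(5 / 4) : ℝ)) := by gcongr
            _ = _ := by rw [← mul_assoc, ← Real.rpow_add hX0]; norm_num
      _ = (X : ℝ) ^ (0.47 : ℝ) * ∑ y ∈ s₂, (y : ℝ) ^ (-(5 / 4) : ℝ) := (Finset.mul_sum _ _ _).symm
      _ ≤ (X : ℝ) ^ (0.47 : ℝ) * C₂ := by gcongr; exact h₂ _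
      _ = _ := mul_comm _ _
  have hMq : M * (ρ.den : ℝ) ^ (0.005 : ℝ) = (X : ℝ) ^ (1 / 2 : ℝ) * (ρ.den : ℝ) ^ (-0.495 : ℝ) *
      (1 + X * |α - ρ|) ^ (-(1 / 4) : ℝ) := by
    have : (ρ.den : ℝ) ^ (-0.495 : ℝ) = (ρ.den : ℝ) ^ (-(1 / 2) : ℝ) * (ρ.den : ℝ) ^ (0.005 : ℝ) := by
      rw [← Real.rpow_add (by linarith)]; norm_num
    rw [this, hM]
    ring
  rw [hMq] at hs₁
  set M' := (X : ℝ) ^ (1 / 2 : ℝ) * (ρ.den : ℝ) ^ (-0.495 : ℝ) *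
      (1 + X * |α - ρ|) ^ (-(1 / 4) : ℝ) with hM'
  have hM'0 : 0 ≤ M' := by positivity
  have hE : 0 ≤ (X : ℝ) ^ (0.47 : ℝ) := by positivity
  calc _ ≤ 4 * C₁ * C₃ * M' + 120 * (X : ℝ) ^ (0.47 : ℝ) + C₂ * (X : ℝ) ^ (0.47 : ℝ) :=
        (norm_add_le _ _).trans (add_le_add hs₁ hs₂)
    _ ≤ (4 * C₁ * C₃ + 120 + C₂) * M' + (4 * C₁ * C₃ + 120 + C₂) * (X : ℝ) ^ (0.47 : ℝ) := by
        have : 0 ≤ 4 * C₁ * C₃ := by positivity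
        nlinarith [mul_nonneg hC₂.le hM'0, mul_nonneg this hE]
    _ = _ := by rw [hM']; ring

theorem integral_sum_unitExp {ι : Type*} (s : Finset ι) (f : ι → ℤ) :
    ∫ α in (0 : ℝ)..1, ∑ i ∈ s, unitExp (f i * α) = ((s.filter fun i => f i = 0).card : ℂ) := by
  rw [intervalIntegral.integral_finsetSum fun i _ =>
    Continuous.intervalIntegrable (by fun_prop) _ _]
  simp_rw [integral_unitExp, Finset.sum_boole]

theorem integral_norm_sum_pow_four_le {ι κ : Type*} [DecidableEq κ] (s : Finset ι) (f : ι → ℤ)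
    (c : ι → κ) (t : Finset κ) (hc : ∀ u ∈ s, c u ∈ t) :
    ∫ α in (0 : ℝ)..1, ‖∑ u ∈ s, unitExp (f u * α)‖ ^ 4 ≤
      t.card * (((s ×ˢ s) ×ˢ (s ×ˢ s)).filter fun w =>
        c w.1.1 = c w.1.2 ∧ f w.1.1 - f w.1.2 + (f w.2.1 - f w.2.2) = 0).card := by
  classical
  set z : ι → ℝ → ℂ := fun u α => unitExp (f u * α) with hz
  set R : ℝ → ℝ := fun α => (∑ y ∈ t, ‖∑ u ∈ s.filter fun u => c u = y, z u α‖ ^ 2) *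
    ‖∑ u ∈ s, z u α‖ ^ 2 with hR
  have hz_cont : ∀ u, Continuous (z u) := fun u => by simp only [hz]; fun_prop
  have hR_cont : Continuous R := by simp only [hR]; fun_prop
  have hpt : ∀ α, ‖∑ u ∈ s, z u α‖ ^ 4 ≤ t.card * R α := by
    intro α
    have h1 : ‖∑ u ∈ s, z u α‖ ≤ ∑ y ∈ t, ‖∑ u ∈ s.filter fun u => c u = y, z u α‖ := by
      rw [← Finset.sum_fiberwise_of_maps_to hc]
      exact norm_sum_le _ _
    have h2 : ‖∑ u ∈ s, z u α‖ ^ 2 ≤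
        t.card * ∑ y ∈ t, ‖∑ u ∈ s.filter fun u => c u = y, z u α‖ ^ 2 :=
      (pow_le_pow_left₀ (norm_nonneg _) h1 2).trans sq_sum_le_card_mul_sum_sq
    calc ‖∑ u ∈ s, z u α‖ ^ 4 = ‖∑ u ∈ s, z u α‖ ^ 2 * ‖∑ u ∈ s, z u α‖ ^ 2 := by ring
      _ ≤ _ := mul_le_mul_of_nonneg_right h2 (by positivity)
      _ = _ := by rw [hR, mul_assoc]
  have hsq : ∀ (A : Finset ι) (α : ℝ), ((‖∑ u ∈ A, z u α‖ ^ 2 : ℝ) : ℂ) =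
      ∑ u ∈ A, ∑ v ∈ A, z u α * (starRingEnd ℂ) (z v α) := by
    intro A α
    rw [Complex.ofReal_pow, ← Complex.mul_conj', map_sum, Finset.sum_mul_sum]
  have hsum : ∀ α, ((R α : ℝ) : ℂ) = ∑ w ∈ ((s ×ˢ s) ×ˢ (s ×ˢ s)).filter fun w =>
      c w.1.1 = c w.1.2, unitExp ((f w.1.1 - f w.1.2 + (f w.2.1 - f w.2.2) : ℤ) * α) := by
    intro α
    have h1 : ((∑ y ∈ t, ‖∑ u ∈ s.filter fun u => c u = y, z u α‖ ^ 2 : ℝ) : ℂ) =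
        ∑ w ∈ (s ×ˢ s).filter fun w => c w.1 = c w.2, z w.1 α * (starRingEnd ℂ) (z w.2 α) := by
      rw [Complex.ofReal_sum]
      simp_rw [hsq]
      rw [Finset.sum_filter, Finset.sum_product, ← Finset.sum_fiberwise_of_maps_to hc]
      refine Finset.sum_congr rfl fun y _ => Finset.sum_congr rfl fun u hu => ?_
      rw [Finset.sum_filter]
      refine Finset.sum_congr rfl fun v _ => ?_
      rw [(Finset.mem_filter.1 hu).2]
      simp only [eq_comm]
    rw [hR, Complex.ofReal_mul, h1, hsq, ← Finset.sum_product', Finset.sum_mul_sum,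
      ← Finset.sum_product']
    refine Finset.sum_congr ?_ fun w _ => ?_
    · ext w
      simp only [Finset.mem_product, Finset.mem_filter]
      tauto
    · simp only [hz]
      rw [← unitExp_neg, ← unitExp_neg, ← unitExp_add, ← unitExp_add, ← unitExp_add]
      congr 1
      push_cast
      ring
  have hint : ∫ α in (0 : ℝ)..1, R α = (((s ×ˢ s) ×ˢ (s ×ˢ s)).filter fun w =>
      c w.1.1 = c w.1.2 ∧ f w.1.1 - f w.1.2 + (f w.2.1 - f w.2.2) = 0).card := by
    have h : ((∫ α in (0 : ℝ)..1, R α : ℝ) : ℂ) = (((s ×ˢ s) ×ˢ (s ×ˢ s)).filter fun w =>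
      c w.1.1 = c w.1.2 ∧ f w.1.1 - f w.1.2 + (f w.2.1 - f w.2.2) = 0).card := by
      rw [← intervalIntegral.integral_ofReal]
      simp_rw [hsum]
      rw [integral_sum_unitExp _ fun w : (ι × ι) × (ι × ι) =>
        f w.1.1 - f w.1.2 + (f w.2.1 - f w.2.2), Finset.filter_filter]
    exact_mod_cast h
  rw [← hint, ← intervalIntegral.integral_const_mul]
  refine intervalIntegral.integral_mono_on zero_le_one
    (Continuous.intervalIntegrable (by fun_prop) _ _)
    (Continuous.intervalIntegrable (by fun_prop) _ _) fun α _ => hpt α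

def sqCube (u : ℕ × ℕ) : ℕ := u.1 ^ 2 * u.2 ^ 3

/-- The pairs of positive integers with `x ^ 2 * y ^ 3 ≤ X`. -/
def sqCubePairs (X : ℕ) : Finset (ℕ × ℕ) :=
  (Finset.Icc 1 X ×ˢ Finset.Icc 1 X).filter fun u => sqCube u ≤ X

theorem mem_sqCubePairs {X : ℕ} {u : ℕ × ℕ} :
    u ∈ sqCubePairs X ↔ 1 ≤ u.1 ∧ 1 ≤ u.2 ∧ sqCube u ≤ X := by
  rw [sqCubePairs, Finset.mem_filter, Finset.mem_product, Finset.mem_Icc, Finset.mem_Icc]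
  refine ⟨fun h => ⟨h.1.1.1, h.1.2.1, h.2⟩, fun ⟨h1, h2, h3⟩ => ⟨⟨⟨h1, ?_⟩, h2, ?_⟩, h3⟩⟩
  · exact ((Nat.le_self_pow two_ne_zero _).trans
      (Nat.le_mul_of_pos_right _ (by positivity))).trans h3
  · exact ((Nat.le_self_pow three_ne_zero _).trans
      (Nat.le_mul_of_pos_left _ (by positivity))).trans h3

theorem le_sqRange_iff {X x y : ℕ} (hy : 1 ≤ y) : x ≤ sqRange X y ↔ sqCube (x, y) ≤ X := by
  rw [sqRange, Nat.le_sqrt, Nat.le_div_iff_mul_le (by positivity), sqCube, sq]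

theorem sqCubeSum_eq (X : ℕ) (α : ℝ) :
    sqCubeSum X α = ∑ u ∈ sqCubePairs X, unitExp ((sqCube u : ℤ) * α) := by
  rw [Finset.sum_finset_product_right (sqCubePairs X) (Finset.Icc 1 X)
    (fun y => Finset.Icc 1 (sqRange X y)) (fun u => ?_)]
  · refine Finset.sum_congr rfl fun y _ => Finset.sum_congr rfl fun x _ => ?_
    congr 1
    simp only [sqCube]
    push_cast
    ring
  · rw [Finset.mem_Icc, Finset.mem_Icc]
    constructor
    · intro h
      have hu := Finset.mem_product.1 (Finset.mem_filter.1 h).1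
      obtain ⟨h1, h2, h3⟩ := mem_sqCubePairs.1 h
      exact ⟨Finset.mem_Icc.1 hu.2, h1, (le_sqRange_iff h2).2 h3⟩
    · rintro ⟨h1, h2, h3⟩
      exact mem_sqCubePairs.2 ⟨h2, h1.1, (le_sqRange_iff h1.1).1 h3⟩

/-- Additive quadruples of `s` whose first difference is taken along a fibre of `Prod.snd`. -/
theorem card_quadruples_le {X Δ : ℕ} (hΔ : ∀ m : ℕ, 1 ≤ m → m ≤ X → m.divisors.card ≤ Δ)
    (s : Finset (ℕ × ℕ)) (hs : s ⊆ sqCubePairs X) :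
    (((s ×ˢ s) ×ˢ (s ×ˢ s)).filter fun w => w.1.1.2 = w.1.2.2 ∧
      ((sqCube w.1.1 : ℤ) - sqCube w.1.2 + (sqCube w.2.1 - sqCube w.2.2)) = 0).card ≤
      2 * (s.card ^ 2 * Δ ^ 2) := by
  classical
  have hmem : ∀ u ∈ s, 1 ≤ u.1 ∧ 1 ≤ u.2 ∧ 1 ≤ sqCube u ∧ sqCube u ≤ X := fun u hu => by
    obtain ⟨h1, h2, h3⟩ := mem_sqCubePairs.1 (hs hu)
    exact ⟨h1, h2, Nat.mul_pos (by positivity) (by positivity), h3⟩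
  set Q := ((s ×ˢ s) ×ˢ (s ×ˢ s)).filter fun w => w.1.1.2 = w.1.2.2 ∧
      ((sqCube w.1.1 : ℤ) - sqCube w.1.2 + (sqCube w.2.1 - sqCube w.2.2)) = 0 with hQ
  have hdiag : (Q.filter fun w => w.1.1 = w.1.2).card ≤ s.card ^ 2 * Δ ^ 2 := by
    have hmaps : ∀ w ∈ Q.filter fun w => w.1.1 = w.1.2, (w.1.1, w.2.1) ∈ s ×ˢ s := by
      intro w hw
      simp only [hQ, Finset.mem_filter, Finset.mem_product] at hw ⊢
      exact ⟨hw.1.1.1.1, hw.1.1.2.1⟩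
    refine (Finset.card_le_mul_card_image_of_maps_to hmaps (Δ ^ 2) fun p hp => ?_).trans_eq
      (by rw [Finset.card_product]; ring)
    obtain ⟨-, hp2⟩ := Finset.mem_product.1 hp
    obtain ⟨-, -, h3, h4⟩ := hmem _ hp2
    have hD := hΔ _ h3 h4
    calc _ ≤ ((sqCube p.2).divisors ×ˢ (sqCube p.2).divisors).card := by
          refine Finset.card_le_card_of_injOn (fun w => w.2.2) ?_ ?_
          · intro w hw
            simp only [hQ, Finset.coe_filter, Finset.mem_filter, Finset.mem_product,
              Set.mem_ofPred_eq] at hw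
            obtain ⟨⟨⟨hw1, hw2, hw3⟩, hw4⟩, rfl⟩ := hw
            rw [hw4] at hw3
            have he : sqCube w.2.1 = sqCube w.2.2 := by omega
            simp only [Finset.coe_product, Set.mem_prod, Finset.mem_coe, Nat.mem_divisors]
            rw [he] at h3 ⊢
            exact ⟨⟨(dvd_pow_self _ two_ne_zero).mul_right _, by omega⟩,
              ⟨(dvd_pow_self _ three_ne_zero).mul_left _, by omega⟩⟩
          · intro w hw w' hw' h
            simp only [hQ, Finset.coe_filter, Finset.mem_filter, Finset.mem_product,
              Set.mem_ofPred_eq] at hw hw'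
            obtain ⟨⟨-, hw4⟩, hwp⟩ := hw
            obtain ⟨⟨-, hw4'⟩, hwp'⟩ := hw'
            have := hwp.trans hwp'.symm
            rw [Prod.mk.injEq] at this
            exact Prod.ext (Prod.ext this.1 (by rw [← hw4, ← hw4', this.1]))
              (Prod.ext this.2 h)
      _ ≤ Δ ^ 2 := by rw [Finset.card_product, sq]; exact Nat.mul_le_mul hD hD
  have hoff : (Q.filter fun w => ¬ w.1.1 = w.1.2).card ≤ s.card ^ 2 * Δ ^ 2 := by
    have hmaps : ∀ w ∈ Q.filter fun w => ¬ w.1.1 = w.1.2, w.2 ∈ s ×ˢ s := by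
      intro w hw
      simp only [hQ, Finset.mem_filter, Finset.mem_product] at hw ⊢
      exact hw.1.1.2
    refine (Finset.card_le_mul_card_image_of_maps_to hmaps (Δ ^ 2) fun p hp => ?_).trans_eq
      (by rw [Finset.card_product]; ring)
    obtain ⟨hp1, hp2⟩ := Finset.mem_product.1 hp
    obtain ⟨-, -, h1, h1'⟩ := hmem _ hp1
    obtain ⟨-, -, h2, h2'⟩ := hmem _ hp2
    set m : ℤ := (sqCube p.2 : ℤ) - sqCube p.1 with hm
    have hfact : ∀ w ∈ (Q.filter fun w => ¬ w.1.1 = w.1.2).filter fun w => w.2 = p,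
        m = ((w.1.1.1 : ℤ) - w.1.2.1) * (w.1.1.1 + w.1.2.1 : ℕ) * (w.1.1.2 : ℤ) ^ 3 ∧
          w.1.1.2 = w.1.2.2 ∧ w.1.1.1 ≠ w.1.2.1 ∧ 1 ≤ w.1.1.1 ∧ 1 ≤ w.1.1.2 ∧ w.2 = p := by
      intro w hw
      simp only [hQ, Finset.mem_filter, Finset.mem_product] at hw
      obtain ⟨⟨⟨hw1, hw2, hw3⟩, hw4⟩, rfl⟩ := hw
      have hpos := hmem _ hw1.1.1
      refine ⟨?_, hw2, fun h => hw4 (Prod.ext h hw2), hpos.1, hpos.2.1, rfl⟩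
      have : m = (sqCube w.1.1 : ℤ) - sqCube w.1.2 := by linarith
      rw [this]
      simp only [sqCube]
      rw [← hw2]
      push_cast
      ring
    rcases ((Q.filter fun w => ¬ w.1.1 = w.1.2).filter fun w => w.2 = p).eq_empty_or_nonempty with
      h0 | ⟨w₀, hw₀⟩
    · rw [h0]; simp
    have hm0 : m ≠ 0 := by
      obtain ⟨e1, -, e2, e3, e4, -⟩ := hfact _ hw₀
      rw [e1]
      have a1 : ((w₀.1.1.1 : ℤ) - w₀.1.2.1) ≠ 0 := sub_ne_zero.2 (by exact_mod_cast e2)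
      have a2 : ((w₀.1.1.1 + w₀.1.2.1 : ℕ) : ℤ) ≠ 0 := by omega
      have a3 : (w₀.1.1.2 : ℤ) ≠ 0 := by omega
      positivity
    have hD := hΔ m.natAbs (by omega) (by omega)
    calc _ ≤ (m.natAbs.divisors ×ˢ m.natAbs.divisors).card := by
          refine Finset.card_le_card_of_injOn (fun w => (w.1.1.2, w.1.1.1 + w.1.2.1)) ?_ ?_
          · intro w hw
            obtain ⟨e1, -, -, -, -, -⟩ := hfact w hw
            simp only [Finset.coe_product, Set.mem_prod, Finset.mem_coe, Nat.mem_divisors]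
            refine ⟨⟨?_, by omega⟩, ⟨?_, by omega⟩⟩
            · rw [← Int.natCast_dvd_natCast, Int.dvd_natAbs, e1]
              exact Dvd.dvd.mul_left (dvd_pow_self _ three_ne_zero) _
            · rw [← Int.natCast_dvd_natCast, Int.dvd_natAbs, e1]
              exact Dvd.dvd.mul_right (dvd_mul_left _ _) _
          · intro w hw w' hw' h
            obtain ⟨e1, e2, -, e3, e4, e5⟩ := hfact w hw
            obtain ⟨e1', e2', -, e3', e4', e5'⟩ := hfact w' hw'
            simp only [Prod.mk.injEq] at h
            rw [e1, ← h.1, ← h.2] at e1'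
            have a2 : ((w.1.1.1 + w.1.2.1 : ℕ) : ℤ) ≠ 0 := by omega
            have a3 : (w.1.1.2 : ℤ) ^ 3 ≠ 0 := by
              have : (w.1.1.2 : ℤ) ≠ 0 := by omega
              positivity
            have := mul_right_cancel₀ a2 (mul_right_cancel₀ a3 e1')
            refine Prod.ext (Prod.ext (Prod.ext ?_ ?_) (Prod.ext ?_ ?_)) (e5.trans e5'.symm) <;> omega
      _ ≤ Δ ^ 2 := by rw [Finset.card_product, sq]; exact Nat.mul_le_mul hD hD
  rw [← Finset.card_filter_add_card_filter_not (s := Q) fun w => w.1.1 = w.1.2]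
  omega

theorem integral_norm_sqCubeSum_pow_four_le_of_card_divisors_le {X Δ : ℕ} (hX : 1 ≤ X)
    (hΔ : ∀ m : ℕ, 1 ≤ m → m ≤ X → m.divisors.card ≤ Δ) :
    ∫ α in (0 : ℝ)..1, ‖sqCubeSum X α‖ ^ 4 ≤ 2 * (Δ : ℝ) ^ 6 * X := by
  set S : ℕ → Finset (ℕ × ℕ) := fun k => (sqCubePairs X).filter fun u => Nat.log 2 u.2 = k with hS
  set K := Nat.log 2 X + 1 with hK
  have hKΔ : K ≤ Δ := by
    have := hΔ (2 ^ Nat.log 2 X) Nat.one_le_two_pow (Nat.pow_log_le_self 2 (by omega))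
    rwa [Nat.divisors_prime_pow Nat.prime_two, Finset.card_map, Finset.card_range] at this
  have hpos : ∀ k, ∀ u ∈ S k, 1 ≤ u.2 ∧ 2 ^ k ≤ u.2 ∧ u.2 < 2 ^ (k + 1) := by
    intro k u hu
    obtain ⟨hu1, rfl⟩ := Finset.mem_filter.1 hu
    obtain ⟨-, h2, -⟩ := mem_sqCubePairs.1 hu1
    exact ⟨h2, Nat.pow_log_le_self 2 (by omega), Nat.lt_pow_succ_log_self one_lt_two _⟩
  have hT : ∀ α, sqCubeSum X α =
      ∑ k ∈ Finset.range K, ∑ u ∈ S k, unitExp ((sqCube u : ℤ) * α) := by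
    intro α
    rw [sqCubeSum_eq, ← Finset.sum_fiberwise_of_maps_to (t := Finset.range K)
      (g := fun u : ℕ × ℕ => Nat.log 2 u.2)]
    intro u hu
    have hu' := Finset.mem_product.1 (Finset.mem_filter.1 hu).1
    rw [Finset.mem_range, hK, Nat.lt_succ_iff]
    exact Nat.log_mono_right (Finset.mem_Icc.1 hu'.2).2
  have hcard : ∀ k, (S k).card ≤ 2 ^ k * sqRange X (2 ^ k) := by
    intro k
    calc (S k).card ≤ (Finset.Icc 1 (sqRange X (2 ^ k)) ×ˢ Finset.Ico (2 ^ k) (2 ^ (k + 1))).card := by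
          refine Finset.card_le_card fun u hu => ?_
          obtain ⟨h1, h2, h3⟩ := hpos k u hu
          obtain ⟨h4, -, h6⟩ := mem_sqCubePairs.1 (Finset.mem_filter.1 hu).1
          rw [Finset.mem_product, Finset.mem_Icc, Finset.mem_Ico]
          refine ⟨⟨h4, (le_sqRange_iff Nat.one_le_two_pow).2 (le_trans ?_ h6)⟩, h2, h3⟩
          exact Nat.mul_le_mul_left _ (Nat.pow_le_pow_left h2 3)
      _ = _ := by
          rw [Finset.card_product, Nat.card_Icc, Nat.card_Ico, pow_succ, mul_comm]
          congr 1; omega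
  have hblock : ∀ k, ∫ α in (0 : ℝ)..1, ‖∑ u ∈ S k, unitExp ((sqCube u : ℤ) * α)‖ ^ 4 ≤
      2 * (Δ : ℝ) ^ 2 * X := by
    intro k
    refine (integral_norm_sum_pow_four_le (S k) (fun u => (sqCube u : ℤ)) Prod.snd
      (Finset.Ico (2 ^ k) (2 ^ (k + 1))) fun u hu => Finset.mem_Ico.2 (hpos k u hu).2).trans ?_
    have h1 := card_quadruples_le hΔ (S k) (Finset.filter_subset _ _)
    have h2 : (Finset.Ico (2 ^ k) (2 ^ (k + 1))).card = 2 ^ k := by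
      rw [Nat.card_Ico, pow_succ]; omega
    have h3 : 2 ^ k * (S k).card ^ 2 ≤ X := by
      calc 2 ^ k * (S k).card ^ 2 ≤ 2 ^ k * (2 ^ k * sqRange X (2 ^ k)) ^ 2 := by gcongr; exact hcard k
        _ = sqCube (sqRange X (2 ^ k), 2 ^ k) := by rw [sqCube]; ring
        _ ≤ X := (le_sqRange_iff Nat.one_le_two_pow).1 le_rfl
    rw [h2]
    have h4 := Nat.mul_le_mul_left (2 ^ k) h1
    have h5 : 2 ^ k * (2 * ((S k).card ^ 2 * Δ ^ 2)) ≤ 2 * Δ ^ 2 * X := by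
      calc _ = 2 * Δ ^ 2 * (2 ^ k * (S k).card ^ 2) := by ring
        _ ≤ _ := Nat.mul_le_mul_left _ h3
    exact_mod_cast h4.trans h5
  have hcont : ∀ k, Continuous fun α : ℝ => ‖∑ u ∈ S k, unitExp ((sqCube u : ℤ) * α)‖ ^ 4 :=
    fun k => by fun_prop
  calc ∫ α in (0 : ℝ)..1, ‖sqCubeSum X α‖ ^ 4
      ≤ ∫ α in (0 : ℝ)..1, (K : ℝ) ^ 3 *
        ∑ k ∈ Finset.range K, ‖∑ u ∈ S k, unitExp ((sqCube u : ℤ) * α)‖ ^ 4 := by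
        simp_rw [hT]
        refine intervalIntegral.integral_mono_on zero_le_one
          (Continuous.intervalIntegrable (by fun_prop) _ _)
          (Continuous.intervalIntegrable (by fun_prop) _ _) fun α _ => ?_
        refine (pow_le_pow_left₀ (norm_nonneg _) (norm_sum_le _ _) 4).trans ?_
        simpa using pow_sum_le_card_mul_sum_pow (s := Finset.range K)
          (fun k _ => norm_nonneg (∑ u ∈ S k, unitExp ((sqCube u : ℤ) * α))) 3
    _ = (K : ℝ) ^ 3 *
        ∑ k ∈ Finset.range K, ∫ α in (0 : ℝ)..1, ‖∑ u ∈ S k, unitExp ((sqCube u : ℤ) * α)‖ ^ 4 := by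
        rw [intervalIntegral.integral_const_mul, intervalIntegral.integral_finsetSum fun k _ =>
          (hcont k).intervalIntegrable _ _]
    _ ≤ (K : ℝ) ^ 3 * ∑ k ∈ Finset.range K, 2 * (Δ : ℝ) ^ 2 * X := by
        gcongr with k; exact hblock k
    _ = 2 * (K : ℝ) ^ 4 * (Δ : ℝ) ^ 2 * X := by
        rw [Finset.sum_const, Finset.card_range, nsmul_eq_mul]; ring
    _ ≤ 2 * (Δ : ℝ) ^ 4 * (Δ : ℝ) ^ 2 * X := by gcongr
    _ = _ := by ring

theorem integral_norm_sqCubeSum_pow_four_le : ∃ C : ℝ, 0 < C ∧ ∀ X : ℕ, 1 ≤ X →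
    ∫ α in (0 : ℝ)..1, ‖sqCubeSum X α‖ ^ 4 ≤ C * (X : ℝ) ^ (1.03 : ℝ) := by
  obtain ⟨D, hD, hdiv⟩ := exists_card_divisors_le_rpow (ε := 0.005) (by norm_num)
  refine ⟨2 * D ^ 6, by positivity, fun X hX => ?_⟩
  have hX' : (0 : ℝ) < X := by exact_mod_cast hX
  refine (integral_norm_sqCubeSum_pow_four_le_of_card_divisors_le (Δ := ⌊D * (X : ℝ) ^ (0.005 : ℝ)⌋₊)
    hX fun m hm hmX => Nat.le_floor ((hdiv m (by omega)).trans ?_)).trans ?_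
  · gcongr
  · calc 2 * (⌊D * (X : ℝ) ^ (0.005 : ℝ)⌋₊ : ℝ) ^ 6 * X ≤ 2 * (D * (X : ℝ) ^ (0.005 : ℝ)) ^ 6 * X := by
          gcongr
          exact Nat.floor_le (by positivity)
      _ = 2 * D ^ 6 * ((X : ℝ) ^ (0.03 : ℝ) * (X : ℝ) ^ (1 : ℝ)) := by
          rw [mul_pow, ← Real.rpow_natCast ((X : ℝ) ^ (0.005 : ℝ)), ← Real.rpow_mul hX'.le,
            Real.rpow_one]
          norm_num
          ring
      _ = _ := by rw [← Real.rpow_add hX']; norm_num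

/-- Integrable majorant of the fifth power of the main term around a rational point. -/
noncomputable def arcWeight (β : ℝ) : ℝ := (1 + |β|) ^ (-(5 / 4) : ℝ)

theorem arcWeight_nonneg (β : ℝ) : 0 ≤ arcWeight β := by
  unfold arcWeight; positivity

@[fun_prop]
theorem continuous_arcWeight : Continuous arcWeight := by
  unfold arcWeight
  exact Continuous.rpow_const (by fun_prop) fun β => Or.inl (by positivity)

theorem integrable_arcWeight : MeasureTheory.Integrable arcWeight := by
  have := integrable_one_add_norm (E := ℝ) (μ := MeasureTheory.volume) (r := 5 / 4)
    (by rw [Module.finrank_self]; norm_num)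
  exact this

theorem integral_arcWeight_mul_sub_le {X : ℕ} (hX : 1 ≤ X) (c : ℝ) :
    ∫ α in (0 : ℝ)..1, arcWeight (X * (α - c)) ≤ (∫ β, arcWeight β) * (X : ℝ)⁻¹ := by
  have hX' : (X : ℝ) ≠ 0 := by positivity
  have hint : MeasureTheory.Integrable fun α : ℝ => arcWeight (X * (α - c)) :=
    ((MeasureTheory.integrable_comp_mul_left_iff _ hX').2 integrable_arcWeight).comp_sub_right c
  calc ∫ α in (0 : ℝ)..1, arcWeight (X * (α - c)) ≤ ∫ α, arcWeight (X * (α - c)) := by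
        rw [intervalIntegral.integral_of_le zero_le_one]
        exact MeasureTheory.setIntegral_le_integral hint
          (Filter.Eventually.of_forall fun α => arcWeight_nonneg _)
    _ = _ := by
        rw [MeasureTheory.integral_sub_right_eq_self (fun α => arcWeight (X * α)) c,
          MeasureTheory.Measure.integral_comp_mul_left, smul_eq_mul, abs_of_nonneg (by positivity),
          mul_comm]

theorem continuous_sqCubeSum (X : ℕ) : Continuous (sqCubeSum X) := by
  unfold sqCubeSum fiberSum; fun_prop

theorem exists_norm_sqCubeSum_pow_five_le : ∃ C : ℝ, 0 < C ∧ ∀ X : ℕ, 1 ≤ X →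
    ∀ α ∈ Set.Icc (0 : ℝ) 1, ‖sqCubeSum X α‖ ^ 5 ≤
      C * (X : ℝ) ^ (0.47 : ℝ) * ‖sqCubeSum X α‖ ^ 4 +
      C * (X : ℝ) ^ (5 / 2 : ℝ) * ∑ q ∈ Finset.Icc 1 (5 * X),
        ∑ a ∈ Finset.Icc (-(2 * q) : ℤ) (2 * q),
          (q : ℝ) ^ (-2.475 : ℝ) * arcWeight (X * (α - a / q)) := by
  obtain ⟨C, hC, hT⟩ := exists_rat_norm_sqCubeSum_le
  refine ⟨max (2 * C) (32 * C ^ 5), by positivity, fun X hX α hα => ?_⟩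
  obtain ⟨ρ, hden, hnum, hle⟩ := hT X hX α hα
  set A := max (2 * C) (32 * C ^ 5)
  have hA1 : 2 * C ≤ A := le_max_left _ _
  have hA2 : 32 * C ^ 5 ≤ A := le_max_right _ _
  set S := ∑ q ∈ Finset.Icc 1 (5 * X), ∑ a ∈ Finset.Icc (-(2 * q) : ℤ) (2 * q),
          (q : ℝ) ^ (-2.475 : ℝ) * arcWeight (X * (α - a / q)) with hS
  have hterm : ∀ (q : ℕ) (a : ℤ), 0 ≤ (q : ℝ) ^ (-2.475 : ℝ) * arcWeight (X * (α - a / q)) :=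
    fun q a => mul_nonneg (by positivity) (arcWeight_nonneg _)
  have hS0 : 0 ≤ S := Finset.sum_nonneg fun q _ => Finset.sum_nonneg fun a _ => hterm q a
  set M := C * (X : ℝ) ^ (1 / 2 : ℝ) * (ρ.den : ℝ) ^ (-0.495 : ℝ) *
    (1 + X * |α - ρ|) ^ (-(1 / 4) : ℝ) with hM
  have hM0 : 0 ≤ M := by positivity
  have hX0 : (0 : ℝ) ≤ X := by positivity
  rcases le_total M (C * (X : ℝ) ^ (0.47 : ℝ)) with h | h
  · have h1 : ‖sqCubeSum X α‖ ≤ A * (X : ℝ) ^ (0.47 : ℝ) := by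
      calc _ ≤ 2 * C * (X : ℝ) ^ (0.47 : ℝ) := by linarith
        _ ≤ _ := by gcongr
    calc ‖sqCubeSum X α‖ ^ 5 = ‖sqCubeSum X α‖ * ‖sqCubeSum X α‖ ^ 4 := by ring
      _ ≤ A * (X : ℝ) ^ (0.47 : ℝ) * ‖sqCubeSum X α‖ ^ 4 := by gcongr
      _ ≤ _ := le_add_of_nonneg_right (by positivity)
  · have h1 : ‖sqCubeSum X α‖ ≤ 2 * M := by linarith
    have h2 : M ^ 5 = C ^ 5 * (X : ℝ) ^ (5 / 2 : ℝ) *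
        ((ρ.den : ℝ) ^ (-2.475 : ℝ) * arcWeight (X * (α - ρ.num / ρ.den))) := by
      rw [hM, mul_pow, mul_pow, mul_pow, ← Real.rpow_mul_natCast hX0,
        ← Real.rpow_mul_natCast (by positivity), ← Real.rpow_mul_natCast (by positivity), arcWeight,
        abs_mul, abs_of_nonneg hX0, ← Rat.cast_def]
      norm_num
      ring
    have h3 : (ρ.den : ℝ) ^ (-2.475 : ℝ) * arcWeight (X * (α - ρ.num / ρ.den)) ≤ S := by
      have hq : ρ.den ∈ Finset.Icc 1 (5 * X) := Finset.mem_Icc.2 ⟨ρ.den_pos, hden⟩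
      have ha : ρ.num ∈ Finset.Icc (-(2 * ρ.den) : ℤ) (2 * ρ.den) :=
        Finset.mem_Icc.2 (abs_le.1 hnum)
      exact (Finset.single_le_sum (f := fun a : ℤ =>
        (ρ.den : ℝ) ^ (-2.475 : ℝ) * arcWeight (X * (α - a / ρ.den)))
        (fun a _ => hterm ρ.den a) ha).trans (Finset.single_le_sum (f := fun q : ℕ =>
        ∑ a ∈ Finset.Icc (-(2 * q) : ℤ) (2 * q),
          (q : ℝ) ^ (-2.475 : ℝ) * arcWeight (X * (α - a / q)))
        (fun q _ => Finset.sum_nonneg fun a _ => hterm q a) hq)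
    calc ‖sqCubeSum X α‖ ^ 5 ≤ (2 * M) ^ 5 := by gcongr
      _ = 32 * C ^ 5 * (X : ℝ) ^ (5 / 2 : ℝ) *
        ((ρ.den : ℝ) ^ (-2.475 : ℝ) * arcWeight (X * (α - ρ.num / ρ.den))) := by
          rw [mul_pow, h2]; ring
      _ ≤ A * (X : ℝ) ^ (5 / 2 : ℝ) * S := by
          have := mul_nonneg (a := (ρ.den : ℝ) ^ (-2.475 : ℝ)) (by positivity)
            (arcWeight_nonneg (X * (α - ρ.num / ρ.den)))
          gcongr
      _ ≤ _ := le_add_of_nonneg_left (by positivity)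

theorem integral_norm_sqCubeSum_pow_five_le : ∃ C : ℝ, 0 < C ∧ ∀ X : ℕ, 1 ≤ X →
    ∫ α in (0 : ℝ)..1, ‖sqCubeSum X α‖ ^ 5 ≤ C * (X : ℝ) ^ (3 / 2 : ℝ) := by
  obtain ⟨C₁, hC₁, hpt⟩ := exists_norm_sqCubeSum_pow_five_le
  obtain ⟨C₂, hC₂, hfour⟩ := integral_norm_sqCubeSum_pow_four_le
  obtain ⟨C₃, hC₃, hsum⟩ := exists_sum_rpow_neg_le (s := 1.475) (by norm_num)
  set H := ∫ β, arcWeight β with hH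
  have hH0 : 0 ≤ H := MeasureTheory.integral_nonneg arcWeight_nonneg
  refine ⟨C₁ * C₂ + C₁ * (5 * C₃ * H), by positivity, fun X hX => ?_⟩
  have hX' : (0 : ℝ) < X := by exact_mod_cast hX
  have hcont := continuous_sqCubeSum X
  set S : ℝ → ℝ := fun α => ∑ q ∈ Finset.Icc 1 (5 * X),
        ∑ a ∈ Finset.Icc (-(2 * q) : ℤ) (2 * q),
          (q : ℝ) ^ (-2.475 : ℝ) * arcWeight (X * (α - a / q)) with hS
  have hScont : Continuous S := by simp only [hS]; fun_prop
  have hSint : ∫ α in (0 : ℝ)..1, S α ≤ 5 * C₃ * H * (X : ℝ)⁻¹ := by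
    simp only [hS]
    rw [intervalIntegral.integral_finsetSum fun q _ =>
      Continuous.intervalIntegrable (by fun_prop) _ _]
    calc _ ≤ ∑ q ∈ Finset.Icc 1 (5 * X), 5 * (H * (X : ℝ)⁻¹) * (q : ℝ) ^ (-1.475 : ℝ) := by
          refine Finset.sum_le_sum fun q hq => ?_
          have hq1 : 1 ≤ q := (Finset.mem_Icc.1 hq).1
          have hq0 : (0 : ℝ) < q := by exact_mod_cast hq1
          rw [intervalIntegral.integral_finsetSum fun a _ =>
            Continuous.intervalIntegrable (by fun_prop) _ _]
          calc _ ≤ ∑ a ∈ Finset.Icc (-(2 * q) : ℤ) (2 * q),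
                (q : ℝ) ^ (-2.475 : ℝ) * (H * (X : ℝ)⁻¹) := by
                refine Finset.sum_le_sum fun a _ => ?_
                rw [intervalIntegral.integral_const_mul]
                gcongr
                exact integral_arcWeight_mul_sub_le hX _
            _ = (4 * q + 1 : ℕ) * ((q : ℝ) ^ (-2.475 : ℝ) * (H * (X : ℝ)⁻¹)) := by
                rw [Finset.sum_const, nsmul_eq_mul, Int.card_Icc]
                congr 2
                omega
            _ ≤ (5 * q) * ((q : ℝ) ^ (-2.475 : ℝ) * (H * (X : ℝ)⁻¹)) := by
                gcongr
                have : (4 * q + 1 : ℕ) ≤ 5 * q := by omega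
                exact_mod_cast this
            _ = 5 * (H * (X : ℝ)⁻¹) * ((q : ℝ) ^ (1 : ℝ) * (q : ℝ) ^ (-2.475 : ℝ)) := by
                rw [Real.rpow_one]; ring
            _ = _ := by rw [← Real.rpow_add hq0]; norm_num
      _ ≤ 5 * (H * (X : ℝ)⁻¹) * C₃ := by
          rw [← Finset.mul_sum]
          gcongr
          exact hsum _
      _ = _ := by ring
  calc ∫ α in (0 : ℝ)..1, ‖sqCubeSum X α‖ ^ 5
      ≤ ∫ α in (0 : ℝ)..1, (C₁ * (X : ℝ) ^ (0.47 : ℝ) * ‖sqCubeSum X α‖ ^ 4 +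
          C₁ * (X : ℝ) ^ (5 / 2 : ℝ) * S α) :=
        intervalIntegral.integral_mono_on zero_le_one
          (Continuous.intervalIntegrable (by fun_prop) _ _)
          (Continuous.intervalIntegrable (by fun_prop) _ _) fun α hα => hpt X hX α hα
    _ = C₁ * (X : ℝ) ^ (0.47 : ℝ) * (∫ α in (0 : ℝ)..1, ‖sqCubeSum X α‖ ^ 4) +
          C₁ * (X : ℝ) ^ (5 / 2 : ℝ) * ∫ α in (0 : ℝ)..1, S α := by
        rw [intervalIntegral.integral_add (Continuous.intervalIntegrable (by fun_prop) _ _)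
          (Continuous.intervalIntegrable (by fun_prop) _ _), intervalIntegral.integral_const_mul,
          intervalIntegral.integral_const_mul]
    _ ≤ C₁ * (X : ℝ) ^ (0.47 : ℝ) * (C₂ * (X : ℝ) ^ (1.03 : ℝ)) +
          C₁ * (X : ℝ) ^ (5 / 2 : ℝ) * (5 * C₃ * H * (X : ℝ)⁻¹) := by
        gcongr
        exact hfour X hX
    _ = C₁ * C₂ * ((X : ℝ) ^ (0.47 : ℝ) * (X : ℝ) ^ (1.03 : ℝ)) +
          C₁ * (5 * C₃ * H) * ((X : ℝ) ^ (5 / 2 : ℝ) * (X : ℝ) ^ (-1 : ℝ)) := by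
        rw [Real.rpow_neg_one]; ring
    _ = _ := by
        rw [← Real.rpow_add hX', ← Real.rpow_add hX']
        norm_num
        ring

theorem sqCubeSum_add_intCast (X : ℕ) (α : ℝ) (m : ℤ) :
    sqCubeSum X (α + m) = sqCubeSum X α := by
  rw [sqCubeSum_eq, sqCubeSum_eq]
  refine Finset.sum_congr rfl fun u _ => ?_
  rw [mul_add, unitExp_add, ← Int.cast_mul, unitExp_intCast, mul_one]

theorem norm_sqCubeSum_neg (X : ℕ) (α : ℝ) : ‖sqCubeSum X (-α)‖ = ‖sqCubeSum X α‖ := by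
  rw [sqCubeSum_eq, sqCubeSum_eq]
  simp_rw [mul_neg, unitExp_neg]
  rw [← map_sum, RCLike.norm_conj]

theorem integral_norm_sqCubeSum_intCast_mul (X k : ℕ) {a : ℤ} (ha : a ≠ 0) :
    ∫ α in (0 : ℝ)..1, ‖sqCubeSum X (a * α)‖ ^ k = ∫ α in (0 : ℝ)..1, ‖sqCubeSum X α‖ ^ k := by
  have ha' : (a : ℝ) ≠ 0 := by exact_mod_cast ha
  have hper : Function.Periodic (fun α => ‖sqCubeSum X α‖ ^ k) 1 := fun α => by
    simpa using congrArg (fun z => ‖z‖ ^ k) (sqCubeSum_add_intCast X α 1)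
  rw [intervalIntegral.integral_comp_mul_left (fun α => ‖sqCubeSum X α‖ ^ k) ha']
  have hcont := continuous_sqCubeSum X
  have := hper.intervalIntegral_add_zsmul_eq a 0 fun _ _ =>
    Continuous.intervalIntegrable (by fun_prop) _ _
  simp only [zero_add, zsmul_eq_mul, mul_one] at this
  rw [mul_zero, mul_one, this, smul_eq_mul, inv_mul_cancel_left₀ ha']

theorem exists_integral_norm_sqCubeSum_pow_le (n : ℕ) (hn : 4 ≤ n) : ∃ C : ℝ, 0 < C ∧
    ∀ X : ℕ, ∫ α in (0 : ℝ)..1, ‖sqCubeSum X α‖ ^ (n + 1) ≤ C * (X : ℝ) ^ (((n : ℝ) - 1) / 2) := by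
  obtain ⟨C₁, hC₁, hle⟩ := norm_sqCubeSum_le
  obtain ⟨C₂, hC₂, hfive⟩ := integral_norm_sqCubeSum_pow_five_le
  refine ⟨C₁ ^ (n - 4) * C₂, by positivity, fun X => ?_⟩
  have hcont := continuous_sqCubeSum X
  rcases Nat.eq_zero_or_pos X with rfl | hX
  · simp only [sqCubeSum, Finset.Icc_eq_empty_of_lt zero_lt_one, Finset.sum_empty, norm_zero]
    rw [zero_pow (by omega), intervalIntegral.integral_zero]
    positivity
  have hX' : (0 : ℝ) < X := by exact_mod_cast hX
  calc ∫ α in (0 : ℝ)..1, ‖sqCubeSum X α‖ ^ (n + 1)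
      ≤ ∫ α in (0 : ℝ)..1, (C₁ * (X : ℝ) ^ (1 / 2 : ℝ)) ^ (n - 4) * ‖sqCubeSum X α‖ ^ 5 := by
        refine intervalIntegral.integral_mono_on zero_le_one
          (Continuous.intervalIntegrable (by fun_prop) _ _)
          (Continuous.intervalIntegrable (by fun_prop) _ _) fun α _ => ?_
        rw [show n + 1 = (n - 4) + 5 by omega, pow_add]
        gcongr
        exact hle X α
    _ ≤ (C₁ * (X : ℝ) ^ (1 / 2 : ℝ)) ^ (n - 4) * (C₂ * (X : ℝ) ^ (3 / 2 : ℝ)) := by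
        rw [intervalIntegral.integral_const_mul]
        gcongr
        exact hfive X hX
    _ = C₁ ^ (n - 4) * C₂ * ((X : ℝ) ^ (1 / 2 * (n - 4 : ℕ) : ℝ) * (X : ℝ) ^ (3 / 2 : ℝ)) := by
        rw [mul_pow, ← Real.rpow_mul_natCast hX'.le]; ring
    _ = _ := by
        rw [← Real.rpow_add hX', Nat.cast_sub hn]
        congr 2
        push_cast
        ring

/-- The pairs in `sqCubePairs X` decorated with the signs of both coordinates. -/
def signedPairs (X : ℕ) : Finset ((ℕ × ℕ) × ℤˣ × ℤˣ) := sqCubePairs X ×ˢ Finset.univ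

def signedValue (w : (ℕ × ℕ) × ℤˣ × ℤˣ) : ℤ := w.2.2 * sqCube w.1

theorem norm_sum_signedPairs_le (X : ℕ) (α : ℝ) :
    ‖∑ w ∈ signedPairs X, unitExp (signedValue w * α)‖ ≤ 4 * ‖sqCubeSum X α‖ := by
  rw [signedPairs, Finset.sum_product_right]
  refine (norm_sum_le _ _).trans ?_
  have h : ∀ ε : ℤˣ × ℤˣ, ‖∑ u ∈ sqCubePairs X, unitExp (signedValue (u, ε) * α)‖ =
      ‖sqCubeSum X α‖ := by
    intro ε
    rcases Int.units_eq_one_or ε.2 with hε | hε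
    · simp [signedValue, hε, sqCubeSum_eq]
    · rw [← norm_sqCubeSum_neg, sqCubeSum_eq]
      simp [signedValue, hε]
  rw [Finset.sum_congr rfl fun ε _ => h ε, Finset.sum_const, nsmul_eq_mul]
  exact le_of_eq (by norm_num [Fintype.card_prod])

theorem card_signed_solutions_le {n : ℕ} (a : Fin (n + 1) → ℤ) (ha : ∀ i, a i ≠ 0) (t : ℤ)
    (X : Fin (n + 1) → ℕ) :
    (((Fintype.piFinset fun i => signedPairs (X i)).filter fun w =>
      ∑ i, a i * signedValue (w i) = t).card : ℝ) ≤
      4 ^ (n + 1) * ∑ i, ∫ α in (0 : ℝ)..1, ‖sqCubeSum (X i) α‖ ^ (n + 1) := by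
  have hcont : ∀ i, Continuous (sqCubeSum (X i)) := fun i => continuous_sqCubeSum _
  have hsum : ∀ α : ℝ, ∑ w ∈ Fintype.piFinset fun i => signedPairs (X i),
      unitExp ((∑ i, a i * signedValue (w i) - t : ℤ) * α) =
      (∏ i, ∑ w ∈ signedPairs (X i), unitExp (signedValue w * (a i * α))) * unitExp (-(t * α)) := by
    intro α
    rw [Finset.prod_univ_sum, Finset.sum_mul]
    refine Finset.sum_congr rfl fun w _ => ?_
    rw [← unitExp_sum, ← unitExp_add]
    congr 1
    push_cast
    rw [sub_mul, Finset.sum_mul, sub_eq_add_neg]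
    congr 1
    exact Finset.sum_congr rfl fun i _ => by ring
  have hcard : (((Fintype.piFinset fun i => signedPairs (X i)).filter fun w =>
      ∑ i, a i * signedValue (w i) = t).card : ℂ) =
      ∫ α in (0 : ℝ)..1, ∑ w ∈ Fintype.piFinset fun i => signedPairs (X i),
        unitExp ((∑ i, a i * signedValue (w i) - t : ℤ) * α) := by
    rw [integral_sum_unitExp _ fun w : Fin (n + 1) → (ℕ × ℕ) × ℤˣ × ℤˣ =>
      ∑ i, a i * signedValue (w i) - t]
    simp only [sub_eq_zero]
  have hpt : ∀ α : ℝ, ‖∑ w ∈ Fintype.piFinset fun i => signedPairs (X i),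
      unitExp ((∑ i, a i * signedValue (w i) - t : ℤ) * α)‖ ≤
      ∑ i, 4 ^ (n + 1) * ‖sqCubeSum (X i) (a i * α)‖ ^ (n + 1) := by
    intro α
    rw [hsum, norm_mul, norm_unitExp, mul_one, norm_prod]
    obtain ⟨j, -, hj⟩ := Finset.exists_max_image Finset.univ
      (fun i => 4 * ‖sqCubeSum (X i) (a i * α)‖) Finset.univ_nonempty
    calc _ ≤ ∏ _i : Fin (n + 1), 4 * ‖sqCubeSum (X j) (a j * α)‖ :=
          Finset.prod_le_prod (fun i _ => norm_nonneg _) fun i hi =>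
            (norm_sum_signedPairs_le _ _).trans (hj i hi)
      _ = 4 ^ (n + 1) * ‖sqCubeSum (X j) (a j * α)‖ ^ (n + 1) := by
          rw [Finset.prod_const, Finset.card_univ, Fintype.card_fin, mul_pow]
      _ ≤ _ := Finset.single_le_sum
          (f := fun i => 4 ^ (n + 1) * ‖sqCubeSum (X i) (a i * α)‖ ^ (n + 1))
          (fun i _ => by positivity) (Finset.mem_univ j)
  calc _ = ‖(((Fintype.piFinset fun i => signedPairs (X i)).filter fun w =>
        ∑ i, a i * signedValue (w i) = t).card : ℂ)‖ := (Complex.norm_natCast _).symm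
    _ ≤ ∫ α in (0 : ℝ)..1, ∑ i, 4 ^ (n + 1) * ‖sqCubeSum (X i) (a i * α)‖ ^ (n + 1) := by
        rw [hcard]
        exact intervalIntegral.norm_integral_le_of_norm_le zero_le_one
          (Filter.Eventually.of_forall fun α _ => hpt α)
          (Continuous.intervalIntegrable (by fun_prop) _ _)
    _ = _ := by
        rw [intervalIntegral.integral_finsetSum fun i _ =>
          Continuous.intervalIntegrable (by fun_prop) _ _, Finset.mul_sum]
        refine Finset.sum_congr rfl fun i _ => ?_
        rw [intervalIntegral.integral_const_mul, integral_norm_sqCubeSum_intCast_mul _ _ (ha i)]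

theorem exists_signedPair {a x y : ℤ} (ha : a ≠ 0) (hx : x ≠ 0) (hy : y ≠ 0) {B : ℝ}
    (h : |(a : ℝ) * (x : ℝ) ^ 2 * (y : ℝ) ^ 3| ≤ B) :
    ∃ w ∈ signedPairs ⌊B / |(a : ℝ)|⌋₊, (w.2.1 * w.1.1 : ℤ) = x ∧ (w.2.2 * w.1.2 : ℤ) = y := by
  have hsign : ∀ z : ℤ, ∃ ε : ℤˣ, ε * (z.natAbs : ℤ) = z := fun z => by
    rcases Int.natAbs_eq z with h | h
    · exact ⟨1, by simpa using h.symm⟩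
    · exact ⟨-1, by simpa using h.symm⟩
  obtain ⟨ε, hε⟩ := hsign x
  obtain ⟨δ, hδ⟩ := hsign y
  refine ⟨((x.natAbs, y.natAbs), ε, δ), Finset.mem_product.2 ⟨mem_sqCubePairs.2
    ⟨Int.natAbs_pos.2 hx, Int.natAbs_pos.2 hy, Nat.le_floor ?_⟩, Finset.mem_univ _⟩, hε, hδ⟩
  have ha' : 0 < |(a : ℝ)| := abs_pos.2 (by exact_mod_cast ha)
  rw [le_div_iff₀ ha', sqCube]
  push_cast
  rw [abs_mul, abs_mul, abs_pow, abs_pow] at h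
  simp only [Nat.cast_natAbs, Int.cast_abs]
  linarith

theorem signedValue_eq (w : (ℕ × ℕ) × ℤˣ × ℤˣ) :
    signedValue w = (w.2.1 * w.1.1 : ℤ) ^ 2 * (w.2.2 * w.1.2 : ℤ) ^ 3 := by
  have h1 : (w.2.1 : ℤ) ^ 2 = 1 := by rcases Int.units_eq_one_or w.2.1 with h | h <;> simp [h]
  have h2 : (w.2.2 : ℤ) ^ 3 = w.2.2 := by rcases Int.units_eq_one_or w.2.2 with h | h <;> simp [h]
  rw [signedValue, sqCube, mul_pow, mul_pow, h1, h2]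
  push_cast
  ring

theorem count_M_at_upper_bound (n : ℕ) (hn : 4 ≤ n) :
    ∃ C > (0:ℝ),
      ∀ a : Fin (n+1) → ℤ, (∀ i, a i ≠ 0) → Finset.univ.gcd a = 1 →
      ∀ t : ℤ, ∀ B : ℝ, 0 < B →
        (Set.ncard {xy : (Fin (n+1) → ℤ) × (Fin (n+1) → ℤ) |
            (∀ i, xy.1 i ≠ 0) ∧ (∀ i, xy.2 i ≠ 0) ∧ (∀ i, Squarefree (xy.2 i)) ∧
            (∑ i, a i * (xy.1 i)^2 * (xy.2 i)^3) = t ∧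
            (∀ i, (|a i * (xy.1 i)^2 * (xy.2 i)^3| : ℝ) ≤ B)} : ℝ)
          ≤ C * B ^ (((n:ℝ) - 1)/2) := by
  classical
  obtain ⟨C, hC, hint⟩ := exists_integral_norm_sqCubeSum_pow_le n hn
  refine ⟨4 ^ (n + 1) * ((n + 1) * C), by positivity, fun a ha _ t B hB => ?_⟩
  set X : Fin (n + 1) → ℕ := fun i => ⌊B / |(a i : ℝ)|⌋₊ with hX
  set A := (Fintype.piFinset fun i => signedPairs (X i)).filter fun w =>
    ∑ i, a i * signedValue (w i) = t with hA
  have hncard : Set.ncard {xy : (Fin (n+1) → ℤ) × (Fin (n+1) → ℤ) |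
            (∀ i, xy.1 i ≠ 0) ∧ (∀ i, xy.2 i ≠ 0) ∧ (∀ i, Squarefree (xy.2 i)) ∧
            (∑ i, a i * (xy.1 i)^2 * (xy.2 i)^3) = t ∧
            (∀ i, (|a i * (xy.1 i)^2 * (xy.2 i)^3| : ℝ) ≤ B)} ≤ A.card := by
    refine le_trans ?_ (Finset.card_image_le (s := A) (f := fun w =>
      ((fun i => ((w i).2.1 * (w i).1.1 : ℤ), fun i => ((w i).2.2 * (w i).1.2 : ℤ)) :
        (Fin (n+1) → ℤ) × (Fin (n+1) → ℤ))))
    rw [← Set.ncard_coe_finset]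
    refine Set.ncard_le_ncard ?_ (Finset.finite_toSet _)
    rintro ⟨x, y⟩ ⟨hx, hy, -, hsum, hle⟩
    choose w hw hwx hwy using fun i => exists_signedPair (ha i) (hx i) (hy i) (hle i)
    refine Finset.mem_coe.2 (Finset.mem_image.2 ⟨w, Finset.mem_filter.2
      ⟨Fintype.mem_piFinset.2 hw, ?_⟩, Prod.ext (funext hwx) (funext hwy)⟩)
    rw [← hsum]
    refine Finset.sum_congr rfl fun i _ => ?_
    rw [signedValue_eq, hwx, hwy, mul_assoc]
  have hXB : ∀ i, (X i : ℝ) ≤ B := fun i => by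
    have h1 : (1 : ℝ) ≤ |(a i : ℝ)| := by exact_mod_cast Int.one_le_abs (ha i)
    exact (Nat.floor_le (by positivity)).trans (div_le_self hB.le h1)
  have hexp : (0 : ℝ) ≤ ((n : ℝ) - 1) / 2 := by
    have : (4 : ℝ) ≤ n := by exact_mod_cast hn
    linarith
  calc _ ≤ (A.card : ℝ) := by exact_mod_cast hncard
    _ ≤ 4 ^ (n + 1) * ∑ i, ∫ α in (0 : ℝ)..1, ‖sqCubeSum (X i) α‖ ^ (n + 1) :=
        card_signed_solutions_le a ha t X
    _ ≤ 4 ^ (n + 1) * ∑ _i : Fin (n + 1), C * B ^ (((n : ℝ) - 1) / 2) := by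
        gcongr with i
        refine (hint (X i)).trans ?_
        gcongr
        exact hXB i
    _ = _ := by
        rw [Finset.sum_const, Finset.card_univ, Fintype.card_fin, nsmul_eq_mul]
        push_cast
        ring
end

section
/- For every ε > 0 there exists a constant C > 0 such that for all reals B ≥ 1 and Y ≥ 1, the number of 7-tuples (x_1, x_2, x_3, x_4, y_1, y_2, y_3) of nonzero integers satisfying 1 ≤ x_i ≤ (B/Y³)^{1/2} for i = 1,…,4, Y < y_j ≤ 2Y for j = 1,2,3, and y_3³·(x_3² − x_4²) = x_1²·y_1³ − x_2²·y_2³, is at most C·B^{1+ε}/Y. -/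
/-- A prime-power factor of the divisor count, for a prime that may be small. -/
lemma natCast_add_one_le_mul_rpow {δ K : ℝ} (hδ : 0 < δ) (hK : 1 ≤ K)
    (hK' : 1 ≤ K * (δ * Real.log 2)) {p : ℕ} (hp : 2 ≤ p) (a : ℕ) :
    (a : ℝ) + 1 ≤ K * ((p : ℝ) ^ a) ^ δ := by
  have hp2 : (2 : ℝ) ≤ p := by exact_mod_cast hp
  have h1 : ((2 : ℝ) ^ a) ^ δ ≤ ((p : ℝ) ^ a) ^ δ := by gcongr
  have h2 : ((2 : ℝ) ^ a) ^ δ = Real.exp (a * (δ * Real.log 2)) := by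
    rw [Real.rpow_def_of_pos (by positivity), Real.log_pow]
    ring_nf
  have h3 := Real.add_one_le_exp ((a : ℝ) * (δ * Real.log 2))
  have ha : (0 : ℝ) ≤ a := a.cast_nonneg
  calc (a : ℝ) + 1 ≤ a * (K * (δ * Real.log 2)) + K := by nlinarith
    _ = K * (a * (δ * Real.log 2) + 1) := by ring
    _ ≤ K * ((p : ℝ) ^ a) ^ δ := by
      gcongr
      exact (h3.trans h2.ge).trans h1

/-- A prime-power factor of the divisor count, for a prime that is large in terms of `δ`. -/
lemma natCast_add_one_le_rpow {δ : ℝ} {p : ℕ} (hp : 2 ≤ (p : ℝ) ^ δ) (a : ℕ) :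
    (a : ℝ) + 1 ≤ ((p : ℝ) ^ a) ^ δ := by
  have h1 : ((p : ℝ) ^ a) ^ δ = ((p : ℝ) ^ δ) ^ a := by
    rw [← Real.rpow_natCast, ← Real.rpow_natCast, ← Real.rpow_mul p.cast_nonneg,
      ← Real.rpow_mul p.cast_nonneg, mul_comm]
  have h2 : (a : ℝ) + 1 ≤ (2 : ℝ) ^ a := by
    exact_mod_cast Nat.succ_le_of_lt a.lt_two_pow_self
  rw [h1]
  exact h2.trans (by gcongr)

/-- The divisor bound: the number of divisors of `n` is `O(n ^ δ)` for every `δ > 0`. -/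
theorem exists_card_divisors_le_mul_rpow {δ : ℝ} (hδ : 0 < δ) :
    ∃ C > (0 : ℝ), ∀ n : ℕ, n ≠ 0 → (n.divisors.card : ℝ) ≤ C * (n : ℝ) ^ δ := by
  have hlog : 0 < δ * Real.log 2 := mul_pos hδ (Real.log_pos one_lt_two)
  set K : ℝ := max 1 (δ * Real.log 2)⁻¹ with hKdef
  have hK : 1 ≤ K := le_max_left _ _
  have hK' : 1 ≤ K * (δ * Real.log 2) := by
    rw [← inv_mul_cancel₀ hlog.ne']
    gcongr
    exact le_max_right _ _
  set M : ℕ := ⌈(2 : ℝ) ^ δ⁻¹⌉₊ with hM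
  refine ⟨K ^ M, by positivity, fun n hn => ?_⟩
  have hprod : (n : ℝ) ^ δ = ∏ p ∈ n.primeFactors, ((p : ℝ) ^ n.factorization p) ^ δ := by
    conv_lhs => rw [← Nat.prod_factorization_pow_eq_self hn]
    rw [Finsupp.prod, Nat.support_factorization, Nat.cast_prod,
      ← Real.finsetProd_rpow _ _ fun _ _ => by positivity]
    simp
  have hlocal : ∀ p ∈ n.primeFactors, (n.factorization p : ℝ) + 1 ≤
      (if p < M then K else 1) * ((p : ℝ) ^ n.factorization p) ^ δ := by
    intro p hp
    split_ifs with hpM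
    · exact natCast_add_one_le_mul_rpow hδ hK hK' (Nat.prime_of_mem_primeFactors hp).two_le _
    · rw [one_mul]
      refine natCast_add_one_le_rpow ?_ _
      have h1 : (2 : ℝ) ^ δ⁻¹ ≤ p := Nat.ceil_le.mp (not_lt.mp hpM)
      calc (2 : ℝ) = ((2 : ℝ) ^ δ⁻¹) ^ δ := by
            rw [← Real.rpow_mul zero_le_two, inv_mul_cancel₀ hδ.ne', Real.rpow_one]
        _ ≤ (p : ℝ) ^ δ := by gcongr
  have hsmall : ∏ p ∈ n.primeFactors, (if p < M then K else 1) ≤ K ^ M := by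
    rw [← Finset.prod_filter, Finset.prod_const]
    refine pow_le_pow_right₀ hK ?_
    calc (n.primeFactors.filter (· < M)).card ≤ (Finset.range M).card :=
          Finset.card_le_card fun p hp => by simpa using (Finset.mem_filter.mp hp).2
      _ = M := Finset.card_range M
  calc (n.divisors.card : ℝ) = ∏ p ∈ n.primeFactors, ((n.factorization p : ℝ) + 1) := by
        rw [Nat.card_divisors hn]
        push_cast
        rfl
    _ ≤ ∏ p ∈ n.primeFactors, (if p < M then K else 1) *
          ((p : ℝ) ^ n.factorization p) ^ δ :=
        Finset.prod_le_prod (fun _ _ => by positivity) hlocal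
    _ = (∏ p ∈ n.primeFactors, (if p < M then K else 1)) * (n : ℝ) ^ δ := by
        rw [Finset.prod_mul_distrib, hprod]
    _ ≤ K ^ M * (n : ℝ) ^ δ := by gcongr

/-- The solutions of the equation in the box `1 ≤ xᵢ ≤ a`, `1 ≤ yⱼ ≤ b`. -/
noncomputable def boxSolutions (a b : ℕ) : Finset ((Fin 4 → ℤ) × (Fin 3 → ℤ)) :=
  ((Fintype.piFinset fun _ => Finset.Icc 1 (a : ℤ)) ×ˢ
    (Fintype.piFinset fun _ => Finset.Icc 1 (b : ℤ))).filter fun xy =>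
      (xy.2 2)^3 * ((xy.1 2)^2 - (xy.1 3)^2) =
        (xy.1 0)^2 * (xy.2 0)^3 - (xy.1 1)^2 * (xy.2 1)^3

lemma mem_boxSolutions {a b : ℕ} {xy : (Fin 4 → ℤ) × (Fin 3 → ℤ)} :
    xy ∈ boxSolutions a b ↔ ((∀ i, 1 ≤ xy.1 i ∧ xy.1 i ≤ a) ∧ ∀ j, 1 ≤ xy.2 j ∧ xy.2 j ≤ b) ∧
      (xy.2 2)^3 * ((xy.1 2)^2 - (xy.1 3)^2) =
        (xy.1 0)^2 * (xy.2 0)^3 - (xy.1 1)^2 * (xy.2 1)^3 := by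
  simp [boxSolutions]

/-- A set of box solutions is small if two of the `x`-variables and two of the `y`-variables
determine the others up to a choice of two divisors of a bounded nonzero integer. -/
lemma card_le_of_divisor_fibers {a b D : ℕ}
    (hD : ∀ n : ℕ, n ≠ 0 → n ≤ a ^ 2 * b ^ 3 → n.divisors.card ≤ D)
    {S : Finset ((Fin 4 → ℤ) × (Fin 3 → ℤ))} (hS : S ⊆ boxSolutions a b)
    (i i' : Fin 4) (j j' : Fin 3) (n : (ℤ × ℤ) × (ℤ × ℤ) → ℕ)
    (g : (Fin 4 → ℤ) × (Fin 3 → ℤ) → ℕ × ℕ)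
    (hn : ∀ s ∈ S, n ((s.1 i, s.1 i'), (s.2 j, s.2 j')) ≠ 0 ∧
      n ((s.1 i, s.1 i'), (s.2 j, s.2 j')) ≤ a ^ 2 * b ^ 3)
    (hg : ∀ s ∈ S, (g s).1 ∣ n ((s.1 i, s.1 i'), (s.2 j, s.2 j')) ∧
      (g s).2 ∣ n ((s.1 i, s.1 i'), (s.2 j, s.2 j')))
    (hinj : ∀ s ∈ S, ∀ t ∈ S, s.1 i = t.1 i → s.1 i' = t.1 i' → s.2 j = t.2 j →
      s.2 j' = t.2 j' → g s = g t → s = t) :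
    S.card ≤ D ^ 2 * (a ^ 2 * b ^ 2) := by
  set f : (Fin 4 → ℤ) × (Fin 3 → ℤ) → (ℤ × ℤ) × (ℤ × ℤ) :=
    fun s => ((s.1 i, s.1 i'), (s.2 j, s.2 j')) with hf
  set X : Finset ℤ := Finset.Icc 1 (a : ℤ)
  set Y : Finset ℤ := Finset.Icc 1 (b : ℤ)
  have hmaps : ∀ s ∈ S, f s ∈ (X ×ˢ X) ×ˢ (Y ×ˢ Y) := by
    intro s hs
    obtain ⟨⟨hx, hy⟩, -⟩ := mem_boxSolutions.mp (hS hs)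
    simp [hf, X, Y, hx, hy]
  refine (Finset.card_le_mul_card_image_of_maps_to hmaps (D ^ 2) ?_).trans (le_of_eq ?_)
  · intro q _
    rcases (S.filter fun s => f s = q).eq_empty_or_nonempty with h | ⟨s₀, hs₀⟩
    · simp [h]
    obtain ⟨hs₀, hq⟩ := Finset.mem_filter.mp hs₀
    obtain ⟨hn0, hnle⟩ := hn s₀ hs₀
    change n (f s₀) ≠ 0 at hn0
    change n (f s₀) ≤ _ at hnle
    rw [hq] at hn0 hnle
    calc (S.filter fun s => f s = q).card
        ≤ ((n q).divisors ×ˢ (n q).divisors).card := by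
          refine Finset.card_le_card_of_injOn g ?_ ?_
          · intro s hs
            obtain ⟨hs, hsq⟩ := Finset.mem_filter.mp hs
            have h := hg s hs
            change (g s).1 ∣ n (f s) ∧ (g s).2 ∣ n (f s) at h
            rw [hsq] at h
            simp [Nat.mem_divisors, h, hn0]
          · intro s hs t ht hst
            obtain ⟨hs, hsq⟩ := Finset.mem_filter.mp hs
            obtain ⟨ht, htq⟩ := Finset.mem_filter.mp ht
            have h := hsq.trans htq.symm
            simp only [hf, Prod.mk.injEq] at h
            exact hinj s hs t ht h.1.1 h.1.2 h.2.1 h.2.2 hst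
      _ ≤ D ^ 2 := by
          rw [Finset.card_product, sq]
          exact Nat.mul_le_mul (hD _ hn0 hnle) (hD _ hn0 hnle)
  · simp only [X, Y, Finset.card_product, Int.card_Icc, add_sub_cancel_right, Int.toNat_natCast]
    ring

lemma sq_mul_cube_mem_Icc {a b : ℕ} {x y : ℤ} (hx : 1 ≤ x ∧ x ≤ a) (hy : 1 ≤ y ∧ y ≤ b) :
    1 ≤ x ^ 2 * y ^ 3 ∧ x ^ 2 * y ^ 3 ≤ (a ^ 2 * b ^ 3 : ℕ) := by
  have hx0 : 0 ≤ x := by lia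
  have hy0 : 0 ≤ y := by lia
  refine ⟨one_le_mul_of_one_le_of_one_le (one_le_pow₀ hx.1) (one_le_pow₀ hy.1), ?_⟩
  push_cast
  have := hx.2
  have := hy.2
  gcongr

/-- Solutions with `x₂ = x₃` are determined by `x₀, x₂, y₀, y₂` and two divisors of
`x₀² y₀³`. -/
lemma card_boxSolutions_diagonal_le {a b D : ℕ}
    (hD : ∀ n : ℕ, n ≠ 0 → n ≤ a ^ 2 * b ^ 3 → n.divisors.card ≤ D) :
    ((boxSolutions a b).filter fun s => s.1 2 = s.1 3).card ≤ D ^ 2 * (a ^ 2 * b ^ 2) := by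
  refine card_le_of_divisor_fibers hD (Finset.filter_subset _ _) 0 2 0 2
    (fun q => (q.1.1 ^ 2 * q.2.1 ^ 3).natAbs) (fun s => ((s.1 1).natAbs, (s.2 1).natAbs)) ?_ ?_ ?_
  · intro s hs
    obtain ⟨⟨hx, hy⟩, -⟩ := mem_boxSolutions.mp (Finset.mem_filter.mp hs).1
    have := sq_mul_cube_mem_Icc (hx 0) (hy 0)
    dsimp only
    lia
  · intro s hs
    obtain ⟨hs, hd⟩ := Finset.mem_filter.mp hs
    obtain ⟨-, he⟩ := mem_boxSolutions.mp hs
    have h : (s.1 0)^2 * (s.2 0)^3 = (s.1 1)^2 * (s.2 1)^3 := by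
      rw [hd] at he
      linarith
    dsimp only
    rw [Int.natAbs_dvd_natAbs, Int.natAbs_dvd_natAbs, h]
    exact ⟨(dvd_pow_self _ two_ne_zero).mul_right _, (dvd_pow_self _ three_ne_zero).mul_left _⟩
  · intro s hs t ht h0 h2 k0 k2 hg
    obtain ⟨hs, hsd⟩ := Finset.mem_filter.mp hs
    obtain ⟨ht, htd⟩ := Finset.mem_filter.mp ht
    obtain ⟨⟨hx, hy⟩, -⟩ := mem_boxSolutions.mp hs
    obtain ⟨⟨hx', hy'⟩, -⟩ := mem_boxSolutions.mp ht
    have h1 : s.1 1 = t.1 1 := by grind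
    have k1 : s.2 1 = t.2 1 := by grind
    have h3 : s.1 3 = t.1 3 := by rw [← hsd, ← htd, h2]
    ext m
    · fin_cases m <;> assumption
    · fin_cases m <;> assumption

/-- Solutions with `x₂ ≠ x₃` are determined by `x₀, x₁, y₀, y₁` and two divisors of
`x₀² y₀³ - x₁² y₁³`. -/
lemma card_boxSolutions_offDiagonal_le {a b D : ℕ}
    (hD : ∀ n : ℕ, n ≠ 0 → n ≤ a ^ 2 * b ^ 3 → n.divisors.card ≤ D) :
    ((boxSolutions a b).filter fun s => s.1 2 ≠ s.1 3).card ≤ D ^ 2 * (a ^ 2 * b ^ 2) := by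
  refine card_le_of_divisor_fibers hD (Finset.filter_subset _ _) 0 1 0 1
    (fun q => (q.1.1 ^ 2 * q.2.1 ^ 3 - q.1.2 ^ 2 * q.2.2 ^ 3).natAbs)
    (fun s => ((s.1 2 + s.1 3).natAbs, (s.2 2).natAbs)) ?_ ?_ ?_
  · intro s hs
    obtain ⟨hs, hd⟩ := Finset.mem_filter.mp hs
    obtain ⟨⟨hx, hy⟩, he⟩ := mem_boxSolutions.mp hs
    have h0 := sq_mul_cube_mem_Icc (hx 0) (hy 0)
    have h1 := sq_mul_cube_mem_Icc (hx 1) (hy 1)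
    dsimp only
    refine ⟨?_, by lia⟩
    rw [← he, Int.natAbs_ne_zero, sq_sub_sq]
    have := hx 2
    have := hx 3
    have := hy 2
    exact mul_ne_zero (pow_ne_zero _ (by lia)) (mul_ne_zero (by lia) (sub_ne_zero.mpr hd))
  · intro s hs
    obtain ⟨-, he⟩ := mem_boxSolutions.mp (Finset.mem_filter.mp hs).1
    dsimp only
    rw [Int.natAbs_dvd_natAbs, Int.natAbs_dvd_natAbs, ← he, sq_sub_sq]
    exact ⟨(dvd_mul_right _ _).mul_left _, (dvd_pow_self _ three_ne_zero).mul_right _⟩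
  · intro s hs t ht h0 h1 k0 k1 hg
    obtain ⟨⟨hx, hy⟩, he⟩ := mem_boxSolutions.mp (Finset.mem_filter.mp hs).1
    obtain ⟨⟨hx', hy'⟩, he'⟩ := mem_boxSolutions.mp (Finset.mem_filter.mp ht).1
    have hx2 := hx 2
    have hx3 := hx 3
    have hy2 := hy 2
    have hx2' := hx' 2
    have hx3' := hx' 3
    have hy2' := hy' 2
    obtain ⟨hg1, hg2⟩ := Prod.mk.inj hg
    have k2 : s.2 2 = t.2 2 := by lia
    have hadd : s.1 2 + s.1 3 = t.1 2 + t.1 3 := by lia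
    rw [h0, h1, k0, k1, k2, ← he', sq_sub_sq, sq_sub_sq, hadd] at he
    have hsub := mul_left_cancel₀ (by lia) (mul_left_cancel₀ (pow_ne_zero 3 (by lia)) he)
    have h2 : s.1 2 = t.1 2 := by lia
    have h3 : s.1 3 = t.1 3 := by lia
    ext m
    · fin_cases m <;> assumption
    · fin_cases m <;> assumption

lemma card_boxSolutions_le {a b D : ℕ}
    (hD : ∀ n : ℕ, n ≠ 0 → n ≤ a ^ 2 * b ^ 3 → n.divisors.card ≤ D) :
    (boxSolutions a b).card ≤ 2 * (D ^ 2 * (a ^ 2 * b ^ 2)) := by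
  rw [← Finset.card_filter_add_card_filter_not (s := boxSolutions a b)
    (fun s => s.1 2 = s.1 3), two_mul]
  exact Nat.add_le_add (card_boxSolutions_diagonal_le hD) (card_boxSolutions_offDiagonal_le hD)

theorem count_Z_bound (ε : ℝ) (hε : 0 < ε) :
    ∃ C > (0:ℝ), ∀ B Y : ℝ, 1 ≤ B → 1 ≤ Y →
      (Set.ncard {xy : (Fin 4 → ℤ) × (Fin 3 → ℤ) |
          (∀ i, 1 ≤ xy.1 i ∧ (xy.1 i : ℝ) ≤ Real.sqrt (B / Y^3)) ∧
          (∀ j, Y < (xy.2 j : ℝ) ∧ (xy.2 j : ℝ) ≤ 2 * Y) ∧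
          (xy.2 2)^3 * ((xy.1 2)^2 - (xy.1 3)^2) =
            (xy.1 0)^2 * (xy.2 0)^3 - (xy.1 1)^2 * (xy.2 1)^3} : ℝ)
        ≤ C * B ^ (1 + ε) / Y := by
  obtain ⟨C, hC, hdiv⟩ := exists_card_divisors_le_mul_rpow (half_pos hε)
  refine ⟨8 * C ^ 2 * 8 ^ ε, by positivity, fun B Y hB hY => ?_⟩
  have hB0 : 0 < B := by linarith
  have hY0 : 0 < Y := by linarith
  set a : ℕ := ⌊Real.sqrt (B / Y ^ 3)⌋₊ with ha
  set b : ℕ := ⌊2 * Y⌋₊ with hb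
  set D : ℕ := ⌊C * (8 * B) ^ (ε / 2)⌋₊ with hDdef
  have ha2 : (a : ℝ) ^ 2 ≤ B / Y ^ 3 := by
    calc (a : ℝ) ^ 2 ≤ Real.sqrt (B / Y ^ 3) ^ 2 := by
          gcongr
          exact Nat.floor_le (Real.sqrt_nonneg _)
      _ = B / Y ^ 3 := Real.sq_sqrt (by positivity)
  have hb1 : (b : ℝ) ≤ 2 * Y := Nat.floor_le (by positivity)
  have hD : ∀ n : ℕ, n ≠ 0 → n ≤ a ^ 2 * b ^ 3 → n.divisors.card ≤ D := by
    intro n hn hle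
    have hn8 : (n : ℝ) ≤ 8 * B := by
      calc (n : ℝ) ≤ (a : ℝ) ^ 2 * (b : ℝ) ^ 3 := by exact_mod_cast hle
        _ ≤ B / Y ^ 3 * (2 * Y) ^ 3 := by gcongr
        _ = 8 * B := by field_simp; norm_num
    refine Nat.le_floor ((hdiv n hn).trans ?_)
    gcongr
  have hD2 : (D : ℝ) ^ 2 ≤ C ^ 2 * (8 ^ ε * B ^ ε) := by
    calc (D : ℝ) ^ 2 ≤ (C * (8 * B) ^ (ε / 2)) ^ 2 := by
          gcongr
          exact Nat.floor_le (by positivity)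
      _ = C ^ 2 * (8 ^ ε * B ^ ε) := by
          rw [mul_pow, ← Real.rpow_natCast ((8 * B) ^ (ε / 2)), ← Real.rpow_mul (by positivity),
            ← Real.mul_rpow (by norm_num) hB0.le]
          norm_num
  have hsub : {xy : (Fin 4 → ℤ) × (Fin 3 → ℤ) |
      (∀ i, 1 ≤ xy.1 i ∧ (xy.1 i : ℝ) ≤ Real.sqrt (B / Y^3)) ∧
      (∀ j, Y < (xy.2 j : ℝ) ∧ (xy.2 j : ℝ) ≤ 2 * Y) ∧
      (xy.2 2)^3 * ((xy.1 2)^2 - (xy.1 3)^2) =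
        (xy.1 0)^2 * (xy.2 0)^3 - (xy.1 1)^2 * (xy.2 1)^3} ⊆ ↑(boxSolutions a b) := by
    rintro xy ⟨hx, hy, he⟩
    refine mem_boxSolutions.mpr ⟨⟨fun i => ⟨(hx i).1, ?_⟩, fun j => ⟨?_, ?_⟩⟩, he⟩
    · rw [ha, Int.natCast_floor_eq_floor (Real.sqrt_nonneg _)]
      exact Int.le_floor.mpr (hx i).2
    · have : (0 : ℝ) < xy.2 j := hY0.trans (hy j).1
      exact_mod_cast this
    · rw [hb, Int.natCast_floor_eq_floor (by positivity)]
      exact Int.le_floor.mpr (hy j).2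
  have hcard := (Set.ncard_le_ncard hsub (Finset.finite_toSet _)).trans
    ((Set.ncard_coe_finset _).trans_le (card_boxSolutions_le hD))
  calc _ ≤ ((2 * (D ^ 2 * (a ^ 2 * b ^ 2)) : ℕ) : ℝ) := by exact_mod_cast hcard
    _ = 2 * ((D : ℝ) ^ 2 * ((a : ℝ) ^ 2 * (b : ℝ) ^ 2)) := by push_cast; rfl
    _ ≤ 2 * (C ^ 2 * (8 ^ ε * B ^ ε) * (B / Y ^ 3 * (2 * Y) ^ 2)) := by gcongr
    _ = 8 * C ^ 2 * 8 ^ ε * B ^ (1 + ε) / Y := by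
      rw [Real.rpow_add hB0, Real.rpow_one]
      field_simp
      ring
end
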